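/- Let G be a planar graph, I ⊆ V(G) an independent set, and L a list assignment such that |L(u) ∩ L(v)| ≤ 1 for every edge uv, |L(v)| ≥ 3 for every v ∈ I, and |L(v)| ≥ 4 for every v ∉ I. Then G admits a proper coloring from L. -/

import Mathlib

open SimpleGraph

/-- A proper coloring of `G` from the list assignment `L`. -/
def ProperListColoring {V : Type*} (G : SimpleGraph V) (L : V → Finset ℕ) (φ : V → ℕ) : Prop :=
  (∀ v, φ v ∈ L v) ∧ ∀ ⦃u v⦄, G.Adj u v → φ u ≠ φ v

/-- `G` is `(k,d)`-choosable. -/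
def Choosable {V : Type*} (G : SimpleGraph V) (k d : ℕ) : Prop :=
  ∀ L : V → Finset ℕ, (∀ v, k ≤ (L v).card) →
    (∀ u v, G.Adj u v → (L u ∩ L v).card ≤ d) →
    ∃ φ, ProperListColoring G L φ

/-- `H` is a minor of `G`. -/
def HasMinor {V W : Type*} (G : SimpleGraph V) (H : SimpleGraph W) : Prop :=
  ∃ B : W → Set V, (∀ w, (B w).Nonempty) ∧
    (Pairwise fun w₁ w₂ => Disjoint (B w₁) (B w₂)) ∧
    (∀ w, (G.induce (B w)).Connected) ∧
    ∀ ⦃w₁ w₂⦄, H.Adj w₁ w₂ → ∃ v₁ ∈ B w₁, ∃ v₂ ∈ B w₂, G.Adj v₁ v₂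

/-- Planarity via Wagner's theorem: no `K₅` minor and no `K₃,₃` minor. -/
def IsPlanar {V : Type*} (G : SimpleGraph V) : Prop :=
  ¬ HasMinor G (⊤ : SimpleGraph (Fin 5)) ∧
  ¬ HasMinor G (completeBipartiteGraph (Fin 3) (Fin 3))

/-- The vertices that can be reached from `a` by walks whose later vertices lie in `Z`. -/
def reachSet {V : Type*} (G : SimpleGraph V) (Z : Set V) (a : V) : Set V :=
  {b | Relation.ReflTransGen (fun s t => G.Adj s t ∧ t ∈ Z) a b}

section Reach

variable {V : Type*} {G : SimpleGraph V} {Z : Set V} {a b c : V}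

theorem self_mem_reachSet : a ∈ reachSet G Z a := Relation.ReflTransGen.refl

theorem reachSet_closed (hb : b ∈ reachSet G Z a) (hbc : G.Adj b c) (hc : c ∈ Z) :
    c ∈ reachSet G Z a :=
  Relation.ReflTransGen.tail hb ⟨hbc, hc⟩

theorem reachSet_subset {T : Set V} (ha : a ∈ T)
    (hT : ∀ s ∈ T, ∀ t ∈ Z, G.Adj s t → t ∈ T) : reachSet G Z a ⊆ T := by
  intro b hb
  induction hb with
  | refl => exact ha
  | tail _ h ih => exact hT _ ih _ h.2 h.1

theorem reachSet_subset_self (ha : a ∈ Z) : reachSet G Z a ⊆ Z :=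
  reachSet_subset ha fun _ _ _ ht _ => ht

theorem reachSet_symm (ha : a ∈ Z) (hb : b ∈ reachSet G Z a) : a ∈ reachSet G Z b := by
  induction hb with
  | refl => exact self_mem_reachSet
  | @tail s t hs h ih =>
    have hsZ : s ∈ Z := reachSet_subset_self ha hs
    exact Relation.ReflTransGen.head ⟨h.1.symm, hsZ⟩ ih

theorem reachSet_trans (hb : b ∈ reachSet G Z a) (hc : c ∈ reachSet G Z b) :
    c ∈ reachSet G Z a :=
  Relation.ReflTransGen.trans hb hc

theorem reachSet_connected (G : SimpleGraph V) (Z : Set V) (a : V) :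
    (G.induce (reachSet G Z a)).Connected := by
  rw [connected_iff_exists_forall_reachable]
  refine ⟨⟨a, self_mem_reachSet⟩, ?_⟩
  rintro ⟨b, hb⟩
  induction hb with
  | refl => exact Reachable.refl _
  | @tail s t hs h ih =>
    have hadj : (G.induce (reachSet G Z a)).Adj ⟨s, hs⟩ ⟨t, reachSet_closed hs h.1 h.2⟩ := h.1
    exact ih.trans hadj.reachable

theorem singleton_connected (G : SimpleGraph V) (a : V) : (G.induce {a}).Connected := by
  rw [connected_iff_exists_forall_reachable]
  refine ⟨⟨a, rfl⟩, ?_⟩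
  rintro ⟨b, hb⟩
  obtain rfl : b = a := hb
  exact Reachable.refl _

theorem insert_connected {B : Set V} (hB : (G.induce B).Connected) (hb : b ∈ B)
    (hab : G.Adj a b) : (G.induce (insert a B)).Connected := by
  rw [connected_iff_exists_forall_reachable]
  refine ⟨⟨b, Or.inr hb⟩, ?_⟩
  rintro ⟨c, rfl | hc⟩
  · have : (G.induce (insert c B)).Adj ⟨b, Or.inr hb⟩ ⟨c, Or.inl rfl⟩ := hab.symm
    exact this.reachable
  · exact (hB.preconnected ⟨b, hb⟩ ⟨c, hc⟩).map
      (G.induceHomOfLE (Set.subset_insert a B)).toHom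

end Reach

section Minor

theorem hasMinor_trans {V U W : Type*} {G : SimpleGraph V} {H : SimpleGraph U}
    {K : SimpleGraph W} (hK : ∀ w, ∃ w', K.Adj w w') (C : U → Set V)
    (hdisj : Pairwise fun a b => Disjoint (C a) (C b))
    (hconn : ∀ ⦃a b⦄, H.Adj a b → (G.induce (C a)).Connected)
    (hadj : ∀ ⦃a b⦄, H.Adj a b → ∃ x ∈ C a, ∃ y ∈ C b, G.Adj x y)
    (h : HasMinor H K) : HasMinor G K := by
  obtain ⟨B, hne, hd, hc, ha⟩ := h
  have hC : ∀ w, ∀ u ∈ B w, (G.induce (C u)).Connected := by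
    intro w u hu
    obtain ⟨w', hw⟩ := hK w
    obtain ⟨v₁, h₁, v₂, -, h₁₂⟩ := ha hw
    obtain ⟨p⟩ := (hc w).preconnected ⟨u, hu⟩ ⟨v₁, h₁⟩
    cases p with
    | nil => exact hconn h₁₂
    | cons h _ => exact hconn (show H.Adj u _ from h)
  refine ⟨fun w => ⋃ u ∈ B w, C u, ?_, ?_, ?_, ?_⟩
  · intro w
    obtain ⟨u, hu⟩ := hne w
    obtain ⟨⟨x, hx⟩⟩ := (hC w u hu).nonempty
    exact ⟨x, Set.mem_biUnion hu hx⟩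
  · intro w₁ w₂ hw
    rw [Set.disjoint_left]
    intro x hx₁ hx₂
    simp only [Set.mem_iUnion] at hx₁ hx₂
    obtain ⟨u₁, hu₁, hx₁⟩ := hx₁
    obtain ⟨u₂, hu₂, hx₂⟩ := hx₂
    have hu : u₁ ≠ u₂ := by
      rintro rfl
      exact Set.disjoint_left.1 (hd hw) hu₁ hu₂
    exact Set.disjoint_left.1 (hdisj hu) hx₁ hx₂
  · intro w
    have key : ∀ u u' : B w, (H.induce (B w)).Walk u u' →
        ∀ x (hx : x ∈ C u) y (hy : y ∈ C u'),
        (G.induce (⋃ u ∈ B w, C u)).Reachable ⟨x, Set.mem_biUnion u.2 hx⟩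
          ⟨y, Set.mem_biUnion u'.2 hy⟩ := by
      intro u u' p
      have inside : ∀ u : B w, ∀ x (hx : x ∈ C u) y (hy : y ∈ C u),
          (G.induce (⋃ u ∈ B w, C u)).Reachable ⟨x, Set.mem_biUnion u.2 hx⟩
            ⟨y, Set.mem_biUnion u.2 hy⟩ := fun u x hx y hy =>
        ((hC w u u.2).preconnected ⟨x, hx⟩ ⟨y, hy⟩).map
          (G.induceHomOfLE (Set.subset_biUnion_of_mem (u := C) u.2)).toHom
      induction p with
      | nil => exact inside _
      | @cons u m u' h p ih =>
        intro x hx y hy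
        obtain ⟨x₁, hx₁, y₁, hy₁, h₁⟩ := hadj (show H.Adj u m from h)
        have hstep : (G.induce (⋃ u ∈ B w, C u)).Adj ⟨x₁, Set.mem_biUnion u.2 hx₁⟩
            ⟨y₁, Set.mem_biUnion m.2 hy₁⟩ := h₁
        exact (inside u x hx x₁ hx₁).trans (hstep.reachable.trans (ih y₁ hy₁ y hy))
    obtain ⟨u, hu⟩ := hne w
    obtain ⟨⟨x, hx⟩⟩ := (hC w u hu).nonempty
    rw [connected_iff_exists_forall_reachable]
    refine ⟨⟨x, Set.mem_biUnion hu hx⟩, ?_⟩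
    rintro ⟨y, hy⟩
    have hy' := hy
    simp only [Set.mem_iUnion] at hy'
    obtain ⟨u', hu', hy'⟩ := hy'
    obtain ⟨p⟩ := (hc w).preconnected ⟨u, hu⟩ ⟨u', hu'⟩
    exact key _ _ p x hx y hy'
  · intro w₁ w₂ hw
    obtain ⟨v₁, h₁, v₂, h₂, h⟩ := ha hw
    obtain ⟨x, hx, y, hy, hxy⟩ := hadj h
    exact ⟨x, Set.mem_biUnion h₁ hx, y, Set.mem_biUnion h₂ hy, hxy⟩

theorem isPlanar_of_model {V U : Type*} {G : SimpleGraph V} {H : SimpleGraph U}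
    (hG : IsPlanar G) (C : U → Set V)
    (hdisj : Pairwise fun a b => Disjoint (C a) (C b))
    (hconn : ∀ ⦃a b⦄, H.Adj a b → (G.induce (C a)).Connected)
    (hadj : ∀ ⦃a b⦄, H.Adj a b → ∃ x ∈ C a, ∃ y ∈ C b, G.Adj x y) : IsPlanar H := by
  refine ⟨fun h => hG.1 (hasMinor_trans ?_ C hdisj hconn hadj h),
    fun h => hG.2 (hasMinor_trans ?_ C hdisj hconn hadj h)⟩
  · intro w
    exact ⟨w + 1, by simp⟩
  · rintro (w | w)
    · exact ⟨Sum.inr 0, by simp⟩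
    · exact ⟨Sum.inl 0, by simp⟩

/-- Some edge of `G` joins `A` to `B`. -/
def SetAdj {V : Type*} (G : SimpleGraph V) (A B : Set V) : Prop :=
  ∃ a ∈ A, ∃ b ∈ B, G.Adj a b

theorem SetAdj.symm {V : Type*} {G : SimpleGraph V} {A B : Set V} (h : SetAdj G A B) :
    SetAdj G B A := by
  obtain ⟨a, ha, b, hb, hab⟩ := h
  exact ⟨b, hb, a, ha, hab.symm⟩

theorem IsPlanar.not_five {V : Type*} {G : SimpleGraph V} (hG : IsPlanar G)
    (B : Fin 5 → Set V) (hc : ∀ i, (G.induce (B i)).Connected)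
    (hd : ∀ i j, i < j → Disjoint (B i) (B j))
    (ha : ∀ i j, i < j → SetAdj G (B i) (B j)) : False := by
  refine hG.1 ⟨B, ?_, ?_, hc, ?_⟩
  · intro i
    obtain ⟨⟨x, hx⟩⟩ := (hc i).nonempty
    exact ⟨x, hx⟩
  · intro i j hij
    rcases lt_or_gt_of_ne hij with h | h
    · exact hd i j h
    · exact (hd j i h).symm
  · intro i j hij
    rcases lt_or_gt_of_ne hij.ne with h | h
    · exact ha i j h
    · exact (ha j i h).symm

theorem IsPlanar.not_three_three {V : Type*} {G : SimpleGraph V} (hG : IsPlanar G)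
    (A B : Fin 3 → Set V) (hA : ∀ i, (G.induce (A i)).Connected)
    (hB : ∀ i, (G.induce (B i)).Connected)
    (hdA : ∀ i j, i < j → Disjoint (A i) (A j))
    (hdB : ∀ i j, i < j → Disjoint (B i) (B j))
    (hdAB : ∀ i j, Disjoint (A i) (B j))
    (ha : ∀ i j, SetAdj G (A i) (B j)) : False := by
  have hne : ∀ S : Set V, (G.induce S).Connected → S.Nonempty := by
    intro S hS
    obtain ⟨⟨x, hx⟩⟩ := hS.nonempty
    exact ⟨x, hx⟩
  refine hG.2 ⟨Sum.elim A B, ?_, ?_, ?_, ?_⟩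
  · rintro (i | i)
    · exact hne _ (hA i)
    · exact hne _ (hB i)
  · rintro (i | i) (j | j) hij
    · rcases lt_or_gt_of_ne (fun h : i = j => hij (by rw [h])) with h | h
      · exact hdA i j h
      · exact (hdA j i h).symm
    · exact hdAB i j
    · exact (hdAB j i).symm
    · rcases lt_or_gt_of_ne (fun h : i = j => hij (by rw [h])) with h | h
      · exact hdB i j h
      · exact (hdB j i h).symm
  · rintro (i | i)
    · exact hA i
    · exact hB i
  · rintro (i | i) (j | j) hij
    · simp at hij
    · exact ha i j
    · exact (ha j i).symm
    · simp at hij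

end Minor

section Obstructions

variable {V : Type*} {G : SimpleGraph V}

theorem IsPlanar.not_three_three_of_connected (hG : IsPlanar G) {a₁ a₂ a₃ b₁ b₂ : V} {K : Set V}
    (hK : (G.induce K).Connected) (ha₁₂ : a₁ ≠ a₂) (ha₁₃ : a₁ ≠ a₃) (ha₂₃ : a₂ ≠ a₃)
    (hb : b₁ ≠ b₂) (hb₁ : b₁ ∉ K) (hb₂ : b₂ ∉ K) (ha₁ : a₁ ∉ K) (ha₂ : a₂ ∉ K) (ha₃ : a₃ ∉ K)
    (h₁₁ : G.Adj a₁ b₁) (h₂₁ : G.Adj a₂ b₁) (h₃₁ : G.Adj a₃ b₁)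
    (h₁₂ : G.Adj a₁ b₂) (h₂₂ : G.Adj a₂ b₂) (h₃₂ : G.Adj a₃ b₂)
    (h₁ : ∃ k ∈ K, G.Adj a₁ k) (h₂ : ∃ k ∈ K, G.Adj a₂ k) (h₃ : ∃ k ∈ K, G.Adj a₃ k) :
    False := by
  refine hG.not_three_three ![{a₁}, {a₂}, {a₃}] ![{b₁}, {b₂}, K] ?_ ?_ ?_ ?_ ?_ ?_
  · intro i
    fin_cases i <;> exact singleton_connected G _
  · intro i
    fin_cases i
    · exact singleton_connected G _
    · exact singleton_connected G _
    · exact hK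
  · intro i j hij
    fin_cases i <;> fin_cases j <;> simp_all
  · intro i j hij
    fin_cases i <;> fin_cases j <;> simp_all
  · intro i j
    fin_cases i <;> fin_cases j <;>
      simp [h₁₁.ne, h₁₂.ne, h₂₁.ne, h₂₂.ne, h₃₁.ne, h₃₂.ne, ha₁, ha₂, ha₃]
  · intro i j
    fin_cases i <;> fin_cases j <;> simpa [SetAdj]

theorem IsPlanar.not_five_of_connected (hG : IsPlanar G) {a b : V} {A B C : Set V}
    (hA : (G.induce A).Connected) (hB : (G.induce B).Connected) (hC : (G.induce C).Connected)
    (hAB : Disjoint A B) (hAC : Disjoint A C) (hBC : Disjoint B C) (hab : G.Adj a b)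
    (haA : a ∉ A) (haB : a ∉ B) (haC : a ∉ C) (hbA : b ∉ A) (hbB : b ∉ B) (hbC : b ∉ C)
    (h₁ : SetAdj G {a} A) (h₂ : SetAdj G {a} B) (h₃ : SetAdj G {a} C)
    (h₄ : SetAdj G {b} A) (h₅ : SetAdj G {b} B) (h₆ : SetAdj G {b} C)
    (h₇ : SetAdj G A B) (h₈ : SetAdj G A C) (h₉ : SetAdj G B C) : False := by
  have hne := hab.ne
  refine hG.not_five ![{a}, {b}, A, B, C] ?_ ?_ ?_
  · intro i
    fin_cases i
    · exact singleton_connected G _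
    · exact singleton_connected G _
    · exact hA
    · exact hB
    · exact hC
  · intro i j hij
    fin_cases i <;> fin_cases j <;> simp_all
  · have h₀ : SetAdj G {a} {b} := ⟨a, rfl, b, rfl, hab⟩
    intro i j hij
    fin_cases i <;> fin_cases j <;> first | assumption | exact absurd hij (by decide)

theorem exists_link {Y : Set V} {x y z : V} (hyz : y ≠ z)
    (h : z ∈ reachSet G Y y) (hY : ∀ t ∈ Y, t ≠ x) :
    ∃ C : Set V, (C = ∅ ∨ ∃ c ∈ Y \ {x, y, z}, C = reachSet G (Y \ {x, y, z}) c ∧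
        SetAdj G {y} C ∧ SetAdj G {z} C) ∧
      (G.induce (insert y C)).Connected ∧ SetAdj G (insert y C) {z} := by
  by_cases hadj : G.Adj y z
  · refine ⟨∅, Or.inl rfl, ?_, y, by simp, z, rfl, hadj⟩
    rw [insert_empty_eq]
    exact singleton_connected G y
  by_contra hno
  have hsub : reachSet G Y y ⊆
      {d | d = y ∨ ∃ c ∈ Y \ {x, y, z}, G.Adj y c ∧ d ∈ reachSet G (Y \ {x, y, z}) c} := by
    refine reachSet_subset (Or.inl rfl) ?_
    intro s hs t ht hst
    by_cases hty : t = y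
    · exact Or.inl hty
    rcases hs with rfl | ⟨c, hc, hyc, hsc⟩
    · by_cases htz : t = z
      · exact absurd (htz ▸ hst) hadj
      · exact Or.inr ⟨t, ⟨ht, by simp [hY t ht, hty, htz]⟩, hst, self_mem_reachSet⟩
    · by_cases htz : t = z
      · subst htz
        refine absurd ⟨_, Or.inr ⟨c, hc, rfl, ⟨y, rfl, c, self_mem_reachSet, hyc⟩,
          ⟨t, rfl, s, hsc, hst.symm⟩⟩, insert_connected (reachSet_connected G _ c)
            self_mem_reachSet hyc, s, Or.inr hsc, t, rfl, hst⟩ hno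
      · exact Or.inr ⟨c, hc, hyc,
          reachSet_closed hsc hst ⟨ht, by simp [hY t ht, hty, htz]⟩⟩
  rcases hsub h with h | ⟨c, hc, -, hzc⟩
  · exact hyz h.symm
  · exact (reachSet_subset_self hc hzc).2 (by simp)

/-- Among three common neighbours of two adjacent vertices of a planar graph, one separates the
other two. -/
theorem IsPlanar.exists_separator (hG : IsPlanar G) {r v x y z : V} {Z : Set V}
    (hrv : G.Adj r v) (hrZ : r ∉ Z) (hvZ : v ∉ Z)
    (hrx : G.Adj r x) (hry : G.Adj r y) (hrz : G.Adj r z)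
    (hvx : G.Adj v x) (hvy : G.Adj v y) (hvz : G.Adj v z)
    (hxy : x ≠ y) (hxz : x ≠ z) (hyz : y ≠ z) :
    z ∉ reachSet G (Z \ {x}) y ∨ x ∉ reachSet G (Z \ {y}) z ∨ y ∉ reachSet G (Z \ {z}) x := by
  by_contra! hcon
  obtain ⟨h₁, h₂, h₃⟩ := hcon
  obtain ⟨C₁, hC₁, hc₁, ha₁⟩ := exists_link (x := x) hyz h₁ (fun t ht => by simpa using ht.2)
  obtain ⟨C₂, hC₂, hc₂, ha₂⟩ := exists_link (x := y) hxz.symm h₂ (fun t ht => by simpa using ht.2)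
  obtain ⟨C₃, hC₃, hc₃, ha₃⟩ := exists_link (x := z) hxy h₃ (fun t ht => by simpa using ht.2)
  have e₁ : (Z \ {x}) \ {x, y, z} = Z \ {x, y, z} := by ext; simp; tauto
  have e₂ : (Z \ {y}) \ {y, z, x} = Z \ {x, y, z} := by ext; simp; tauto
  have e₃ : (Z \ {z}) \ {z, x, y} = Z \ {x, y, z} := by ext; simp; tauto
  rw [e₁] at hC₁
  rw [e₂] at hC₂
  rw [e₃] at hC₃
  have hno : ∀ c ∈ Z \ {x, y, z}, SetAdj G {x} (reachSet G (Z \ {x, y, z}) c) →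
      SetAdj G {y} (reachSet G (Z \ {x, y, z}) c) →
      SetAdj G {z} (reachSet G (Z \ {x, y, z}) c) → False := by
    intro c hc hcx hcy hcz
    have hsub := reachSet_subset_self (G := G) hc
    refine hG.not_three_three_of_connected (reachSet_connected G (Z \ {x, y, z}) c)
      hxy hxz hyz hrv.ne (fun h => hrZ (hsub h).1) (fun h => hvZ (hsub h).1)
      (fun h => (hsub h).2 (by simp)) (fun h => (hsub h).2 (by simp))
      (fun h => (hsub h).2 (by simp)) hrx.symm hry.symm hrz.symm hvx.symm hvy.symm hvz.symm
      ?_ ?_ ?_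
    · simpa [SetAdj] using hcx
    · simpa [SetAdj] using hcy
    · simpa [SetAdj] using hcz
  have hsub : ∀ {C : Set V} {P : Prop},
      (C = ∅ ∨ ∃ c ∈ Z \ {x, y, z}, C = reachSet G (Z \ {x, y, z}) c ∧ P) →
      C ⊆ Z \ {x, y, z} := by
    rintro C P (rfl | ⟨c, hc, rfl, -⟩)
    · simp
    · exact reachSet_subset_self hc
  have hdis : ∀ {C C' : Set V} {a b a' b' : V},
      (C = ∅ ∨ ∃ c ∈ Z \ {x, y, z}, C = reachSet G (Z \ {x, y, z}) c ∧
        SetAdj G {a} C ∧ SetAdj G {b} C) →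
      (C' = ∅ ∨ ∃ c ∈ Z \ {x, y, z}, C' = reachSet G (Z \ {x, y, z}) c ∧
        SetAdj G {a'} C' ∧ SetAdj G {b'} C') →
      (∀ C, SetAdj G {a} C ∧ SetAdj G {b} C → SetAdj G {a'} C ∧ SetAdj G {b'} C → SetAdj G {x} C ∧ SetAdj G {y} C ∧ SetAdj G {z} C) → Disjoint C C' := by
    rintro C C' a b a' b' (rfl | ⟨c, hc, rfl, hP⟩) (rfl | ⟨c', hc', rfl, hP'⟩) hPP
    · simp
    · simp
    · simp
    rw [Set.disjoint_left]
    intro d hd hd'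
    have heq : reachSet G (Z \ {x, y, z}) c = reachSet G (Z \ {x, y, z}) c' := by
      ext e
      exact ⟨fun he => reachSet_trans hd' (reachSet_trans (reachSet_symm hc hd) he),
        fun he => reachSet_trans hd (reachSet_trans (reachSet_symm hc' hd') he)⟩
    obtain ⟨h₁, h₂, h₃⟩ := hPP _ hP (heq ▸ hP')
    exact hno c hc h₁ h₂ h₃
  have hs₁ := hsub hC₁
  have hs₂ := hsub hC₂
  have hs₃ := hsub hC₃
  have hd₁₂ := hdis hC₁ hC₂ (by tauto)
  have hd₁₃ := hdis hC₁ hC₃ (by tauto)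
  have hd₂₃ := hdis hC₂ hC₃ (by tauto)
  have hxs : x ∉ Z \ {x, y, z} := by simp
  have hys : y ∉ Z \ {x, y, z} := by simp
  have hzs : z ∉ Z \ {x, y, z} := by simp
  have hrs : r ∉ Z \ {x, y, z} := fun h => hrZ h.1
  have hvs : v ∉ Z \ {x, y, z} := fun h => hvZ h.1
  have hdisj : ∀ {a b : V} {A B : Set V}, a ≠ b → Disjoint A B → a ∉ B → b ∉ A →
      Disjoint (insert a A) (insert b B) := by
    intro a b A B h₁ h₂ h₃ h₄
    simp [h₁.symm, h₂, h₃, h₄]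
  have hins : ∀ {a b : V} {A : Set V}, a ≠ b → a ∉ A → a ∉ insert b A := by
    intro a b A h₁ h₂
    simp [h₁, h₂]
  have hadj : ∀ {a b : V} {A : Set V}, G.Adj a b → SetAdj G {a} (insert b A) :=
    fun h => ⟨_, rfl, _, Or.inl rfl, h⟩
  have hmono : ∀ {A B : Set V} {b : V}, SetAdj G A {b} → SetAdj G A (insert b B) := by
    rintro A B b ⟨a, ha, _, rfl, h⟩
    exact ⟨a, ha, _, Or.inl rfl, h⟩
  refine hG.not_five_of_connected hc₁ hc₂ hc₃ (hdisj hyz hd₁₂ (fun h => hys (hs₂ h))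
    (fun h => hzs (hs₁ h))) (hdisj hxy.symm hd₁₃ (fun h => hys (hs₃ h)) (fun h => hxs (hs₁ h)))
    (hdisj hxz.symm hd₂₃ (fun h => hzs (hs₃ h)) (fun h => hxs (hs₂ h))) hrv
    (hins hry.ne fun h => hrs (hs₁ h)) (hins hrz.ne fun h => hrs (hs₂ h))
    (hins hrx.ne fun h => hrs (hs₃ h)) (hins hvy.ne fun h => hvs (hs₁ h))
    (hins hvz.ne fun h => hvs (hs₂ h)) (hins hvx.ne fun h => hvs (hs₃ h))
    (hadj hry) (hadj hrz) (hadj hrx) (hadj hvy) (hadj hvz) (hadj hvx)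
    (hmono ha₁) ?_ (hmono ha₂)
  exact (hmono ha₃).symm

end Obstructions

section Reduction

variable {V : Type*}

/-- The set `X` is to be colored from `L`. Adjacency to `p` or to `r` may cost a vertex one color,
and `q` is a precolored vertex whose color is not removed from the lists. -/
structure Reduced (G : SimpleGraph V) (X I : Set V) (p q r : V) (L : V → Finset ℕ) : Prop where
  planar : IsPlanar G
  p_notMem : p ∉ X
  q_notMem : q ∉ X
  r_notMem : r ∉ X
  adj_pq : (∃ x ∈ X, G.Adj p x) → (∃ x ∈ X, G.Adj q x) → G.Adj p q
  adj_pr : (∃ x ∈ X, G.Adj p x) → (∃ x ∈ X, G.Adj r x) → G.Adj p r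
  adj_qr : (∃ x ∈ X, G.Adj q x) → (∃ x ∈ X, G.Adj r x) → G.Adj q r
  indep : ∀ u ∈ X, u ∈ I → ∀ v ∈ X, v ∈ I → ¬ G.Adj u v
  p_indep : ∀ u ∈ X, u ∈ I → ¬ G.Adj p u
  sep : ∀ u ∈ X, ∀ v ∈ X, G.Adj u v → (L u ∩ L v).card ≤ 1
  two_le : ∀ u ∈ X, 2 ≤ (L u).card
  three_le_of_mem : ∀ u ∈ X, u ∈ I → ¬ G.Adj r u → 3 ≤ (L u).card
  three_le_of_not_p : ∀ u ∈ X, u ∉ I → ¬ G.Adj p u → 3 ≤ (L u).card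
  three_le_of_not_r : ∀ u ∈ X, u ∉ I → ¬ G.Adj r u → 3 ≤ (L u).card
  four_le : ∀ u ∈ X, u ∉ I → ¬ G.Adj p u → ¬ G.Adj r u → 4 ≤ (L u).card
  isolated : ∃ o ∉ X, ∀ x, ¬ G.Adj o x

/-- The set `X` is properly colorable from `L`, avoiding `d` at the neighbours of `q`. -/
def HasColoring (G : SimpleGraph V) (X : Set V) (q : V) (d : ℕ) (L : V → Finset ℕ) : Prop :=
  ∃ φ : V → ℕ, ∀ u ∈ X, φ u ∈ L u ∧ (G.Adj q u → φ u ≠ d) ∧ ∀ v ∈ X, G.Adj u v → φ u ≠ φ v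

/-- Every reduced configuration on fewer than `n` vertices has a coloring. -/
def ColoringBelow (I : Set V) (n : ℕ) : Prop :=
  ∀ (G : SimpleGraph V) (X : Set V) (p q r : V) (d : ℕ) (L : V → Finset ℕ),
    X.ncard < n → Reduced G X I p q r L → HasColoring G X q d L

variable {G : SimpleGraph V} {X I : Set V} {p q r : V} {d : ℕ} {L : V → Finset ℕ}

theorem Reduced.mono (h : Reduced G X I p q r L) {Y : Set V} (hY : Y ⊆ X) :
    Reduced G Y I p q r L where
  planar := h.planar
  p_notMem := fun hp => h.p_notMem (hY hp)
  q_notMem := fun hp => h.q_notMem (hY hp)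
  r_notMem := fun hp => h.r_notMem (hY hp)
  adj_pq := fun ⟨x, hx, hpx⟩ ⟨y, hy, hqy⟩ => h.adj_pq ⟨x, hY hx, hpx⟩ ⟨y, hY hy, hqy⟩
  adj_pr := fun ⟨x, hx, hpx⟩ ⟨y, hy, hqy⟩ => h.adj_pr ⟨x, hY hx, hpx⟩ ⟨y, hY hy, hqy⟩
  adj_qr := fun ⟨x, hx, hpx⟩ ⟨y, hy, hqy⟩ => h.adj_qr ⟨x, hY hx, hpx⟩ ⟨y, hY hy, hqy⟩
  indep := fun u hu hI v hv => h.indep u (hY hu) hI v (hY hv)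
  p_indep := fun u hu => h.p_indep u (hY hu)
  sep := fun u hu v hv => h.sep u (hY hu) v (hY hv)
  two_le := fun u hu => h.two_le u (hY hu)
  three_le_of_mem := fun u hu => h.three_le_of_mem u (hY hu)
  three_le_of_not_p := fun u hu => h.three_le_of_not_p u (hY hu)
  three_le_of_not_r := fun u hu => h.three_le_of_not_r u (hY hu)
  four_le := fun u hu => h.four_le u (hY hu)
  isolated := by
    obtain ⟨o, ho, h'⟩ := h.isolated
    exact ⟨o, fun hp => ho (hY hp), h'⟩

theorem card_sdiff_ge (S A : Finset ℕ) {k : ℕ} (hA : A.card ≤ k) : S.card ≤ (S \ A).card + k := by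
  have := Finset.le_card_sdiff A S
  omega

open Classical in
theorem Reduced.hasColoring_of_split [Finite V] (h : Reduced G X I p q r L)
    (ih : ColoringBelow I X.ncard) {D : Set V} (hDX : D ⊆ X) (hD : D.Nonempty) (hne : D ≠ X)
    {p' q' r' : V}
    (hp : p' = p ∨ (∀ u ∈ D, ¬ G.Adj p u) ∧ ((p' ∉ X ∧ ∀ x, ¬ G.Adj p' x) ∨ p' ∈ X \ D ∧ p' ∈ I))
    (hq : q' = q ∨ (∀ u ∈ D, ¬ G.Adj q u) ∧ q' ∈ X \ D)
    (hr : r' = r ∨ (∀ u ∈ D, ¬ G.Adj r u) ∧ r' ∈ X \ D)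
    (hpq : (∃ u ∈ D, G.Adj p' u) → (∃ u ∈ D, G.Adj q' u) → G.Adj p' q')
    (hpr : (∃ u ∈ D, G.Adj p' u) → (∃ u ∈ D, G.Adj r' u) → G.Adj p' r')
    (hqr : (∃ u ∈ D, G.Adj q' u) → (∃ u ∈ D, G.Adj r' u) → G.Adj q' r')
    (hcover : ∀ u ∈ D, ∀ x ∈ X \ D, G.Adj u x → x = p' ∨ x = q' ∨ x = r') :
    HasColoring G X q d L := by
  obtain ⟨φ₁, h₁⟩ := ih G (X \ D) p q r d L
    (Set.ncard_lt_ncard (by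
      refine ⟨Set.sdiff_subset, fun hX => ?_⟩
      obtain ⟨x, hx⟩ := hD
      exact (hX (hDX hx)).2 hx)) (h.mono Set.sdiff_subset)
  have hp'D : p' ∉ D := by
    rcases hp with rfl | ⟨-, hp | hp⟩
    · exact fun hm => h.p_notMem (hDX hm)
    · exact fun hm => hp.1 (hDX hm)
    · exact hp.1.2
  have hq'D : q' ∉ D := by
    rcases hq with rfl | ⟨-, hq⟩
    · exact fun hm => h.q_notMem (hDX hm)
    · exact hq.2
  have hr'D : r' ∉ D := by
    rcases hr with rfl | ⟨-, hr⟩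
    · exact fun hm => h.r_notMem (hDX hm)
    · exact hr.2
  obtain ⟨A, hA⟩ : ∃ A : V → Finset ℕ,
      A = fun u => if p' ∈ X ∧ G.Adj p' u then {φ₁ p'} else ∅ := ⟨_, rfl⟩
  obtain ⟨B, hB⟩ : ∃ B : V → Finset ℕ,
      B = fun u => if r' ∈ X ∧ G.Adj r' u then {φ₁ r'} else ∅ := ⟨_, rfl⟩
  have hAcard : ∀ u ∈ D, (A u = ∅ ∧ (G.Adj p u → G.Adj p' u)) ∨
      (¬ G.Adj p u ∧ G.Adj p' u ∧ (A u).card ≤ 1) := by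
    intro u hu
    rcases hp with rfl | ⟨hp, -⟩
    · left
      simp [hA, h.p_notMem]
    · by_cases hpu : G.Adj p' u
      · right
        refine ⟨hp u hu, hpu, ?_⟩
        rw [hA]
        dsimp only
        split_ifs <;> simp
      · left
        simp [hA, hpu, hp u hu]
  have hBcard : ∀ u ∈ D, (B u = ∅ ∧ (G.Adj r u → G.Adj r' u)) ∨
      (¬ G.Adj r u ∧ G.Adj r' u ∧ (B u).card ≤ 1) := by
    intro u hu
    rcases hr with rfl | ⟨hr, -⟩
    · left
      simp [hB, h.r_notMem]
    · by_cases hru : G.Adj r' u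
      · right
        refine ⟨hr u hu, hru, ?_⟩
        rw [hB]
        dsimp only
        split_ifs <;> simp
      · left
        simp [hB, hru, hr u hu]
  have hp'I : ∀ u ∈ D, u ∈ I → ¬ G.Adj p' u := by
    intro u hu huI
    rcases hp with rfl | ⟨-, hp | hp⟩
    · exact h.p_indep u (hDX hu) huI
    · exact hp.2 u
    · exact h.indep p' hp.1.1 hp.2 u (hDX hu) huI
  have hAI : ∀ u ∈ D, u ∈ I → A u = ∅ := by
    intro u hu huI
    simp [hA, hp'I u hu huI]
  have hcard : ∀ u, (L u).card ≤ ((L u \ A u) \ B u).card + (A u).card + (B u).card := by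
    intro u
    have h₁ := card_sdiff_ge (L u) (A u) le_rfl
    have h₂ := card_sdiff_ge (L u \ A u) (B u) le_rfl
    omega
  have hred : Reduced G D I p' q' r' (fun u => (L u \ A u) \ B u) := by
    refine ⟨h.planar, hp'D, hq'D, hr'D, hpq, hpr, hqr,
      fun u hu huI v hv => h.indep u (hDX hu) huI v (hDX hv), hp'I, ?_, ?_, ?_, ?_, ?_, ?_, ?_⟩
    · intro u hu v hv huv
      refine le_trans (Finset.card_le_card ?_) (h.sep u (hDX hu) v (hDX hv) huv)
      exact Finset.inter_subset_inter (Finset.sdiff_subset.trans Finset.sdiff_subset)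
        (Finset.sdiff_subset.trans Finset.sdiff_subset)
    · intro u hu
      have h0 := hcard u
      have h2 := h.two_le u (hDX hu)
      by_cases huI : u ∈ I
      · have h3 := h.three_le_of_mem u (hDX hu) huI
        rw [hAI u hu huI] at h0 ⊢
        rcases hBcard u hu with ⟨hb, -⟩ | ⟨hb, -, hb1⟩
        · simp only [hb, Finset.card_empty] at h0 ⊢
          omega
        · have := h3 hb
          simp only [Finset.card_empty] at h0
          omega
      · have h3 := h.three_le_of_not_p u (hDX hu) huI
        have h3' := h.three_le_of_not_r u (hDX hu) huI
        have h4 := h.four_le u (hDX hu) huI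
        rcases hBcard u hu with ⟨hb, -⟩ | ⟨hb, -, hb1⟩ <;>
        rcases hAcard u hu with ⟨ha, -⟩ | ⟨ha, -, ha1⟩
        · simp only [ha, hb, Finset.card_empty] at h0 ⊢
          omega
        · have := h3 ha
          simp only [hb, Finset.card_empty] at h0 ⊢
          omega
        · have := h3' hb
          simp only [ha, Finset.card_empty] at h0 ⊢
          omega
        · have := h4 ha hb
          omega
    · intro u hu huI hru
      have h0 := hcard u
      have h3 := h.three_le_of_mem u (hDX hu) huI
      rw [hAI u hu huI] at h0 ⊢
      rcases hBcard u hu with ⟨hb, hb'⟩ | ⟨-, hb, -⟩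
      · have := h3 fun h => hru (hb' h)
        simp only [hb, Finset.card_empty] at h0 ⊢
        omega
      · exact absurd hb hru
    · intro u hu huI hpu
      have h0 := hcard u
      have h3 := h.three_le_of_not_p u (hDX hu) huI
      have h4 := h.four_le u (hDX hu) huI
      rcases hAcard u hu with ⟨ha, ha'⟩ | ⟨-, ha, -⟩
      · have hpu' : ¬ G.Adj p u := fun h => hpu (ha' h)
        have := h3 hpu'
        simp only [ha, Finset.card_empty] at h0 ⊢
        rcases hBcard u hu with ⟨hb, -⟩ | ⟨hb, -, hb1⟩
        · simp only [hb, Finset.card_empty] at h0 ⊢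
          omega
        · have := h4 hpu' hb
          omega
      · exact absurd ha hpu
    · intro u hu huI hru
      have h0 := hcard u
      have h3 := h.three_le_of_not_r u (hDX hu) huI
      have h4 := h.four_le u (hDX hu) huI
      rcases hBcard u hu with ⟨hb, hb'⟩ | ⟨-, hb, -⟩
      · have hru' : ¬ G.Adj r u := fun h => hru (hb' h)
        have := h3 hru'
        simp only [hb, Finset.card_empty] at h0 ⊢
        rcases hAcard u hu with ⟨ha, -⟩ | ⟨ha, -, ha1⟩
        · simp only [ha, Finset.card_empty] at h0 ⊢
          omega
        · have := h4 ha hru'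
          omega
      · exact absurd hb hru
    · intro u hu huI hpu hru
      have h0 := hcard u
      have h4 := h.four_le u (hDX hu) huI
      rcases hBcard u hu with ⟨hb, hb'⟩ | ⟨-, hb, -⟩
      · rcases hAcard u hu with ⟨ha, ha'⟩ | ⟨-, ha, -⟩
        · have := h4 (fun h => hpu (ha' h)) (fun h => hru (hb' h))
          simp only [ha, hb, Finset.card_empty] at h0 ⊢
          omega
        · exact absurd ha hpu
      · exact absurd hb hru
    · obtain ⟨o, ho, h'⟩ := h.isolated
      exact ⟨o, fun hm => ho (hDX hm), h'⟩
  obtain ⟨d', hd'⟩ : ∃ d' : ℕ, (q' = q → d' = d) ∧ (q' ≠ q → d' = φ₁ q') := by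
    by_cases hqq : q' = q
    · exact ⟨d, fun _ => rfl, fun h => absurd hqq h⟩
    · exact ⟨φ₁ q', fun h => absurd h hqq, fun _ => rfl⟩
  obtain ⟨φ₂, h₂⟩ := ih G D p' q' r' d' _ (Set.ncard_lt_ncard ⟨hDX, fun hX =>
    hne (Set.Subset.antisymm hDX hX)⟩) hred
  have hcross : ∀ u ∈ D, ∀ x ∈ X \ D, G.Adj u x → φ₂ u ≠ φ₁ x := by
    intro u hu x hx hux
    obtain ⟨hL, hd, -⟩ := h₂ u hu
    simp only [Finset.mem_sdiff] at hL
    rcases hcover u hu x hx hux with rfl | rfl | rfl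
    · intro he
      refine hL.1.2 ?_
      simp [hA, hx.1, hux.symm, he]
    · have : x ≠ q := fun he => h.q_notMem (he ▸ hx.1)
      rw [← hd'.2 this]
      exact hd hux.symm
    · intro he
      refine hL.2 ?_
      simp [hB, hx.1, hux.symm, he]
  refine ⟨fun u => if u ∈ D then φ₂ u else φ₁ u, ?_⟩
  intro u hu
  by_cases huD : u ∈ D
  · obtain ⟨hL, hd, hc⟩ := h₂ u huD
    simp only [Finset.mem_sdiff] at hL
    simp only [huD, if_true]
    refine ⟨hL.1.1, ?_, ?_⟩
    · intro hqu
      rcases hq with rfl | hq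
      · rw [← hd'.1 rfl]
        exact hd hqu
      · exact absurd hqu (hq.1 u huD)
    · intro v hv huv
      by_cases hvD : v ∈ D
      · simpa only [hvD, if_true] using hc v hvD huv
      · simpa only [hvD, if_false] using hcross u huD v ⟨hv, hvD⟩ huv
  · obtain ⟨hL, hd, hc⟩ := h₁ u ⟨hu, huD⟩
    simp only [huD, if_false]
    refine ⟨hL, hd, ?_⟩
    intro v hv huv
    by_cases hvD : v ∈ D
    · simpa only [hvD, if_true] using (hcross v hvD u ⟨hu, huD⟩ huv.symm).symm
    · simpa only [hvD, if_false] using hc v ⟨hv, hvD⟩ huv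

/-- The graph obtained from `G` by contracting `v` into `r`, leaving `v` isolated. -/
def contractInto (G : SimpleGraph V) (r v : V) : SimpleGraph V where
  Adj a b := a ≠ b ∧ a ≠ v ∧ b ≠ v ∧ (G.Adj a b ∨ a = r ∧ G.Adj v b ∨ b = r ∧ G.Adj v a)
  symm := ⟨fun a b h => ⟨h.1.symm, h.2.2.1, h.2.1, by
    rcases h.2.2.2 with h | h | h
    · exact Or.inl h.symm
    · exact Or.inr (Or.inr h)
    · exact Or.inr (Or.inl h)⟩⟩
  loopless := ⟨fun a h => h.1 rfl⟩

open Classical in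
theorem IsPlanar.contractInto {v : V} (hG : IsPlanar G) (hrv : G.Adj r v) :
    IsPlanar (contractInto G r v) := by
  refine isPlanar_of_model hG
    (fun u => if u = v then ∅ else if u = r then {r, v} else {u}) ?_ ?_ ?_
  · intro a b hab
    rw [Set.disjoint_left]
    intro x hx hx'
    split_ifs at hx hx' <;> simp_all
  · intro a b hab
    have hav := hab.2.1
    rw [if_neg hav]
    by_cases har : a = r
    · rw [if_pos har]
      exact insert_connected (singleton_connected G v) rfl hrv
    · rw [if_neg har]
      exact singleton_connected G a
  · rintro a b ⟨hab, ha, hb, h⟩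
    simp only [ha, hb, if_false]
    rcases h with h | ⟨rfl, h⟩ | ⟨rfl, h⟩
    · refine ⟨a, ?_, b, ?_, h⟩ <;> split_ifs with he <;> simp [he]
    · refine ⟨v, by simp, b, ?_, h⟩
      simp [hab.symm]
    · refine ⟨a, ?_, v, by simp, h.symm⟩
      simp [hab]

open Classical in
theorem Reduced.exists_contract_coloring [Finite V] (h : Reduced G X I p q r L)
    (ih : ColoringBelow I X.ncard) {v : V} (hv : v ∈ X) (hrv : G.Adj r v) (E : Set V) (d : ℕ) :
    ∃ φ : V → ℕ, ∀ u ∈ X, u ≠ v → u ∉ E → φ u ∈ L u ∧ (G.Adj q u → φ u ≠ d) ∧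
      (G.Adj v u → ¬ G.Adj r u → φ u ∉ L v) ∧
      ∀ w ∈ X, w ≠ v → w ∉ E → G.Adj u w → φ u ≠ φ w := by
  have hact : ∃ x ∈ X, G.Adj r x := ⟨v, hv, hrv⟩
  have hadj : ∀ a b, a ≠ v → b ≠ v → a ≠ r → b ≠ r →
      ((contractInto G r v).Adj a b ↔ G.Adj a b) := by
    intro a b ha hb har hbr
    constructor
    · rintro ⟨-, -, -, h | h | h⟩
      · exact h
      · exact absurd h.1 har
      · exact absurd h.1 hbr
    · exact fun h => ⟨h.ne, ha, hb, Or.inl h⟩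
  have hr_adj : ∀ b, b ≠ v → b ≠ r →
      ((contractInto G r v).Adj r b ↔ G.Adj r b ∨ G.Adj v b) := by
    intro b hb hbr
    constructor
    · rintro ⟨-, -, -, h | h | h⟩
      · exact Or.inl h
      · exact Or.inr h.2
      · exact absurd h.1 hbr
    · rintro (h | h)
      · exact ⟨h.ne, hrv.ne, hb, Or.inl h⟩
      · exact ⟨hbr.symm, hrv.ne, hb, Or.inr (Or.inl ⟨rfl, h⟩)⟩
  obtain ⟨Y, hY⟩ : ∃ Y : Set V, Y = {u | u ∈ X ∧ u ≠ v ∧ u ∉ E} := ⟨_, rfl⟩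
  have hYX : ∀ u ∈ Y, u ∈ X := by
    intro u hu
    rw [hY] at hu
    exact hu.1
  have hYv : ∀ u ∈ Y, u ≠ v := by
    intro u hu
    rw [hY] at hu
    exact hu.2.1
  have hYr : ∀ u ∈ Y, u ≠ r := fun u hu he => h.r_notMem (he ▸ hYX u hu)
  have hpv : p ≠ v := fun he => h.p_notMem (he ▸ hv)
  have hqv : q ≠ v := fun he => h.q_notMem (he ▸ hv)
  have hspecial : ∀ s, s ≠ v → ((∃ x ∈ X, G.Adj s x) → G.Adj s r) →
      ∀ u ∈ Y, ((contractInto G r v).Adj s u ↔ G.Adj s u) := by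
    intro s hs hsr u hu
    refine hadj s u hs (hYv u hu) ?_ (hYr u hu)
    rintro rfl
    exact (hsr hact).ne rfl
  have hpY := hspecial p hpv fun hp => h.adj_pr hp hact
  have hqY := hspecial q hqv fun hq => h.adj_qr hq hact
  have hrY : ∀ u ∈ Y, ((contractInto G r v).Adj r u ↔ G.Adj r u ∨ G.Adj v u) :=
    fun u hu => hr_adj u (hYv u hu) (hYr u hu)
  have hYY : ∀ u ∈ Y, ∀ w ∈ Y, ((contractInto G r v).Adj u w ↔ G.Adj u w) :=
    fun u hu w hw => hadj u w (hYv u hu) (hYv w hw) (hYr u hu) (hYr w hw)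
  have hup : ∀ s t, s ≠ v → t ≠ v → G.Adj s t → (contractInto G r v).Adj s t :=
    fun s t hs ht h => ⟨h.ne, hs, ht, Or.inl h⟩
  have hpact : (∃ x ∈ Y, (contractInto G r v).Adj p x) → ∃ x ∈ X, G.Adj p x :=
    fun ⟨x, hx, hpx⟩ => ⟨x, hYX x hx, (hpY x hx).1 hpx⟩
  have hqact : (∃ x ∈ Y, (contractInto G r v).Adj q x) → ∃ x ∈ X, G.Adj q x :=
    fun ⟨x, hx, hqx⟩ => ⟨x, hYX x hx, (hqY x hx).1 hqx⟩
  have hsub : ∀ u, (if G.Adj v u ∧ ¬ G.Adj r u then L u \ L v else L u) ⊆ L u := by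
    intro u
    split_ifs
    · exact Finset.sdiff_subset
    · exact Finset.Subset.refl _
  have hcard : ∀ u ∈ Y, G.Adj v u → (L u).card ≤ (L u \ L v).card + 1 := by
    intro u hu hvu
    have h₁ := h.sep u (hYX u hu) v hv hvu.symm
    have h₂ := Finset.card_sdiff_add_card_inter (L u) (L v)
    omega
  have hred : Reduced (contractInto G r v) Y I p q r
      (fun u => if G.Adj v u ∧ ¬ G.Adj r u then L u \ L v else L u) := by
    refine ⟨h.planar.contractInto hrv, fun hm => h.p_notMem (hYX _ hm),
      fun hm => h.q_notMem (hYX _ hm), fun hm => h.r_notMem (hYX _ hm),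
      fun h₁ h₂ => hup _ _ hpv hqv (h.adj_pq (hpact h₁) (hqact h₂)),
      fun h₁ _ => hup _ _ hpv hrv.ne (h.adj_pr (hpact h₁) hact),
      fun h₁ _ => hup _ _ hqv hrv.ne (h.adj_qr (hqact h₁) hact), ?_, ?_, ?_, ?_, ?_, ?_, ?_, ?_, ?_⟩
    · intro u hu huI w hw hwI
      rw [hYY u hu w hw]
      exact h.indep u (hYX u hu) huI w (hYX w hw) hwI
    · intro u hu huI
      rw [hpY u hu]
      exact h.p_indep u (hYX u hu) huI
    · intro u hu w hw huw
      rw [hYY u hu w hw] at huw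
      exact le_trans (Finset.card_le_card (Finset.inter_subset_inter (hsub u) (hsub w)))
        (h.sep u (hYX u hu) w (hYX w hw) huw)
    · intro u hu
      have h2 := h.two_le u (hYX u hu)
      split_ifs with hc
      · have h1 := hcard u hu hc.1
        by_cases huI : u ∈ I
        · have := h.three_le_of_mem u (hYX u hu) huI hc.2
          omega
        · have := h.three_le_of_not_r u (hYX u hu) huI hc.2
          omega
      · exact h2
    · intro u hu huI hru
      rw [hrY u hu] at hru
      push Not at hru
      simp only [hru.2, false_and, if_false]
      exact h.three_le_of_mem u (hYX u hu) huI hru.1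
    · intro u hu huI hpu
      rw [hpY u hu] at hpu
      split_ifs with hc
      · have h1 := hcard u hu hc.1
        have := h.four_le u (hYX u hu) huI hpu hc.2
        omega
      · exact h.three_le_of_not_p u (hYX u hu) huI hpu
    · intro u hu huI hru
      rw [hrY u hu] at hru
      push Not at hru
      simp only [hru.2, false_and, if_false]
      exact h.three_le_of_not_r u (hYX u hu) huI hru.1
    · intro u hu huI hpu hru
      rw [hpY u hu] at hpu
      rw [hrY u hu] at hru
      push Not at hru
      simp only [hru.2, false_and, if_false]
      exact h.four_le u (hYX u hu) huI hpu hru.1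
    · obtain ⟨o, ho, hiso⟩ := h.isolated
      refine ⟨o, fun hm => ho (hYX _ hm), ?_⟩
      rintro x ⟨-, -, -, hx | ⟨rfl, -⟩ | ⟨-, hx⟩⟩
      · exact hiso x hx
      · exact hiso v hrv
      · exact hiso v hx.symm
  have hYcard : Y.ncard < X.ncard :=
    Set.ncard_lt_ncard ⟨hYX, fun hX => hYv v (hX hv) rfl⟩
  obtain ⟨φ, hφ⟩ := ih _ Y p q r d _ hYcard hred
  refine ⟨φ, fun u hu huv huE => ?_⟩
  have huY : u ∈ Y := by
    rw [hY]
    exact ⟨hu, huv, huE⟩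
  obtain ⟨h₁, h₂, h₃⟩ := hφ u huY
  refine ⟨hsub u h₁, fun hqu => h₂ ((hqY u huY).2 hqu), ?_, ?_⟩
  · intro hvu hru hm
    simp only [hvu, hru, not_false_eq_true, and_self, if_true, Finset.mem_sdiff] at h₁
    exact h₁.2 hm
  · intro w hw hwv hwE huw
    have hwY : w ∈ Y := by
      rw [hY]
      exact ⟨hw, hwv, hwE⟩
    exact h₃ w hwY ((hYY u huY w hwY).2 huw)

end Reduction

section Critical

variable {V : Type*} {G : SimpleGraph V} {X I : Set V} {p q r v : V} {d : ℕ} {L : V → Finset ℕ}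

theorem Reduced.adj_p_r (h : Reduced G X I p q r L) (hv : v ∈ X) (hrv : G.Adj r v) {x : V}
    (hx : x ∈ X) (hpx : G.Adj p x) : G.Adj p r :=
  h.adj_pr ⟨x, hx, hpx⟩ ⟨v, hv, hrv⟩

theorem Reduced.adj_q_r (h : Reduced G X I p q r L) (hv : v ∈ X) (hrv : G.Adj r v) {x : V}
    (hx : x ∈ X) (hqx : G.Adj q x) : G.Adj q r :=
  h.adj_qr ⟨x, hx, hqx⟩ ⟨v, hv, hrv⟩

theorem Reduced.r_notMem_union (h : Reduced G X I p q r L) (hv : v ∈ X) (hrv : G.Adj r v) :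
    r ∉ X ∪ {p, q} := by
  rintro (hr | rfl | rfl)
  · exact h.r_notMem hr
  · exact (h.adj_p_r hv hrv hv hrv).ne rfl
  · exact (h.adj_q_r hv hrv hv hrv).ne rfl

theorem Reduced.p_ne_q (h : Reduced G X I p q r L) {x : V} (hx : x ∈ X) (hpx : G.Adj p x) :
    p ≠ q := by
  rintro rfl
  exact (h.adj_pq ⟨x, hx, hpx⟩ ⟨x, hx, hpx⟩).ne rfl

open Classical in
/-- Colorings that extend from the contraction of `v` into `r`. -/
theorem Reduced.hasColoring_of_contract [Finite V] (h : Reduced G X I p q r L)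
    (ih : ColoringBelow I X.ncard) (hv : v ∈ X) (hrv : G.Adj r v) (E : Set V) (hvE : v ∉ E)
    (hE : ∀ w ∈ E, ∀ w' ∈ E, ¬ G.Adj w w')
    (hext : ∀ φ : V → ℕ, ∃ α ∈ L v, (G.Adj q v → α ≠ d) ∧
      (∀ y ∈ X, G.Adj v y → G.Adj r y → y ∉ E → φ y ≠ α) ∧
      ∀ w ∈ E, ∃ β ∈ L w, β ≠ α ∧ (G.Adj q w → β ≠ d) ∧
        ∀ y ∈ X, y ≠ v → G.Adj w y → β ≠ φ y) : HasColoring G X q d L := by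
  obtain ⟨φ, hφ⟩ := h.exists_contract_coloring ih hv hrv E d
  obtain ⟨α, hα, hqα, hvα, hEα⟩ := hext φ
  choose! β hβ hβα hqβ hβφ using hEα
  have hvw : ∀ w ∈ X, w ≠ v → w ∉ E → G.Adj v w → φ w ≠ α := by
    intro w hw hwv hwE hvw
    by_cases hrw : G.Adj r w
    · exact hvα w hw hvw hrw hwE
    · rintro rfl
      exact (hφ w hw hwv hwE).2.2.1 hvw hrw hα
  refine ⟨fun u => if u = v then α else if u ∈ E then β u else φ u, ?_⟩
  intro u hu
  by_cases huv : u = v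
  · subst huv
    simp only [if_true]
    refine ⟨hα, hqα, ?_⟩
    intro w hw huw
    have hwu : w ≠ u := huw.ne'
    by_cases hwE : w ∈ E
    · simpa only [hwu, hwE, if_false, if_true] using (hβα w hwE).symm
    · simpa only [hwu, hwE, if_false] using (hvw w hw hwu hwE huw).symm
  by_cases huE : u ∈ E
  · simp only [huv, huE, if_false, if_true]
    refine ⟨hβ u huE, hqβ u huE, ?_⟩
    intro w hw huw
    by_cases hwv : w = v
    · simpa only [hwv, if_true] using hβα u huE
    · have hwE : w ∉ E := fun hwE => hE u huE w hwE huw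
      simpa only [hwv, hwE, if_false] using hβφ u huE w hw hwv huw
  · simp only [huv, huE, if_false]
    obtain ⟨h₁, h₂, -, h₃⟩ := hφ u hu huv huE
    refine ⟨h₁, h₂, ?_⟩
    intro w hw huw
    by_cases hwv : w = v
    · subst hwv
      simpa only [if_true] using hvw u hu huv huE huw.symm
    by_cases hwE : w ∈ E
    · simpa only [hwv, hwE, if_false, if_true] using (hβφ w hwE u hu huv huw.symm).symm
    · simpa only [hwv, hwE, if_false] using h₃ w hw hwv hwE huw

open Classical in
theorem Reduced.exists_two_common [Finite V] (h : Reduced G X I p q r L)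
    (ih : ColoringBelow I X.ncard) (hno : ¬ HasColoring G X q d L) (hv : v ∈ X)
    (hrv : G.Adj r v) :
    ∃ y₁ y₂, y₁ ≠ y₂ ∧ ((y₁ ∈ X ∨ y₁ = q) ∧ G.Adj v y₁ ∧ G.Adj r y₁) ∧
      (y₂ ∈ X ∨ y₂ = q) ∧ G.Adj v y₂ ∧ G.Adj r y₂ := by
  by_contra hcon
  obtain ⟨y, hy⟩ : ∃ y, ∀ z, (z ∈ X ∨ z = q) → G.Adj v z → G.Adj r z → z = y := by
    by_cases hex : ∃ y, (y ∈ X ∨ y = q) ∧ G.Adj v y ∧ G.Adj r y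
    · obtain ⟨y, hy⟩ := hex
      refine ⟨y, fun z hz hvz hrz => ?_⟩
      by_contra hzy
      exact hcon ⟨y, z, fun he => hzy he.symm, hy, hz, hvz, hrz⟩
    · exact ⟨v, fun z hz hvz hrz => absurd ⟨z, hz, hvz, hrz⟩ hex⟩
  refine hno (h.hasColoring_of_contract ih hv hrv ∅ (by simp) (by simp) ?_)
  intro φ
  obtain ⟨α, hα, hne⟩ := Finset.exists_mem_ne (h.two_le v hv) (if y = q then d else φ y)
  refine ⟨α, hα, ?_, ?_, by simp⟩
  · intro hqv
    have hyq := hy q (Or.inr rfl) hqv.symm (h.adj_q_r hv hrv hv hqv).symm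
    simpa [← hyq] using hne
  · intro z hz hvz hrz _
    have hzy := hy z (Or.inl hz) hvz hrz
    have hzq : z ≠ q := fun he => h.q_notMem (he ▸ hz)
    rw [← hzy, if_neg hzq] at hne
    exact hne.symm

/-- A subset of `X` attached only to `v` and `y` forces `y` to be neither `p` nor in `I`. -/
theorem Reduced.attachment [Finite V] (h : Reduced G X I p q r L)
    (ih : ColoringBelow I X.ncard) (hno : ¬ HasColoring G X q d L) (hv : v ∈ X)
    (hrv : G.Adj r v) {D : Set V} (hDX : D ⊆ X) (hD : D.Nonempty) (hvD : v ∉ D) {y : V}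
    (hyD : y ∉ D) (hry : G.Adj r y) (hvy : G.Adj v y)
    (hcl : ∀ s ∈ D, ∀ t ∈ X ∪ {p, q}, G.Adj s t → t ∈ D ∨ t = v ∨ t = y) :
    y ≠ p ∧ ¬ (y ∈ X ∧ y ∈ I) := by
  have hne : D ≠ X := fun he => hvD (he ▸ hv)
  have hpv : p ≠ v := fun he => h.p_notMem (he ▸ hv)
  have hqv : q ≠ v := fun he => h.q_notMem (he ▸ hv)
  have hpD : p ∉ D := fun hm => h.p_notMem (hDX hm)
  have hqD : q ∉ D := fun hm => h.q_notMem (hDX hm)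
  constructor
  · rintro rfl
    refine hno (h.hasColoring_of_split ih hDX hD hne (p' := y) (q' := v) (r' := r)
      (Or.inl rfl) (Or.inr ⟨?_, hv, hvD⟩) (Or.inl rfl) (fun _ _ => hvy.symm)
      (fun _ _ => hry.symm) (fun _ _ => hrv.symm) ?_)
    · intro u hu hqu
      rcases hcl u hu q (by simp) hqu.symm with h' | h' | h'
      · exact hqD h'
      · exact hqv h'
      · exact h.p_ne_q hv hvy.symm h'.symm
    · intro u hu x hx hux
      rcases hcl u hu x (Or.inl hx.1) hux with h' | h' | h'
      · exact absurd h' hx.2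
      · exact Or.inr (Or.inl h')
      · exact Or.inl h'
  · rintro ⟨hyX, hyI⟩
    have hpy : p ≠ y := fun he => h.p_notMem (he ▸ hyX)
    have hqy : q ≠ y := fun he => h.q_notMem (he ▸ hyX)
    refine hno (h.hasColoring_of_split ih hDX hD hne (p' := y) (q' := v) (r' := r)
      (Or.inr ⟨?_, Or.inr ⟨⟨hyX, hyD⟩, hyI⟩⟩) (Or.inr ⟨?_, hv, hvD⟩) (Or.inl rfl)
      (fun _ _ => hvy.symm) (fun _ _ => hry.symm) (fun _ _ => hrv.symm) ?_)
    · intro u hu hpu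
      rcases hcl u hu p (by simp) hpu.symm with h' | h' | h'
      · exact hpD h'
      · exact hpv h'
      · exact hpy h'
    · intro u hu hqu
      rcases hcl u hu q (by simp) hqu.symm with h' | h' | h'
      · exact hqD h'
      · exact hqv h'
      · exact hqy h'
    · intro u hu x hx hux
      rcases hcl u hu x (Or.inl hx.1) hux with h' | h' | h'
      · exact absurd h' hx.2
      · exact Or.inr (Or.inl h')
      · exact Or.inl h'

theorem Reduced.not_attached_single [Finite V] (h : Reduced G X I p q r L)
    (ih : ColoringBelow I X.ncard) (hno : ¬ HasColoring G X q d L) (hv : v ∈ X)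
    (hrv : G.Adj r v) {D : Set V} (hDX : D ⊆ X) (hD : D.Nonempty) (hvD : v ∉ D)
    (hcl : ∀ s ∈ D, ∀ t ∈ X ∪ {p, q}, G.Adj s t → t ∈ D ∨ t = v) : False := by
  have hne : D ≠ X := fun he => hvD (he ▸ hv)
  have hpv : p ≠ v := fun he => h.p_notMem (he ▸ hv)
  have hqv : q ≠ v := fun he => h.q_notMem (he ▸ hv)
  have hpD : p ∉ D := fun hm => h.p_notMem (hDX hm)
  have hqD : q ∉ D := fun hm => h.q_notMem (hDX hm)
  obtain ⟨o, ho, hiso⟩ := h.isolated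
  refine hno (h.hasColoring_of_split ih hDX hD hne (p' := o) (q' := v) (r' := r)
    (Or.inr ⟨?_, Or.inl ⟨ho, hiso⟩⟩) (Or.inr ⟨?_, hv, hvD⟩) (Or.inl rfl)
    (fun ⟨u, _, hou⟩ => absurd hou (hiso u)) (fun ⟨u, _, hou⟩ => absurd hou (hiso u))
    (fun _ _ => hrv.symm) ?_)
  · intro u hu hpu
    rcases hcl u hu p (by simp) hpu.symm with h' | h'
    · exact hpD h'
    · exact hpv h'
  · intro u hu hqu
    rcases hcl u hu q (by simp) hqu.symm with h' | h'
    · exact hqD h'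
    · exact hqv h'
  · intro u hu x hx hux
    rcases hcl u hu x (Or.inl hx.1) hux with h' | h'
    · exact absurd h' hx.2
    · exact Or.inr (Or.inl h')

theorem exists_adj_of_mem_reachSet {Z : Set V} {s t a : V} (hZ : Z ⊆ X ∪ {s, t}) (ha : a ∈ Z)
    (hv : v ∈ X) (hva : G.Adj v a) (hs : s ∈ reachSet G Z a) (ht : t ∉ reachSet G Z a) :
    ∃ x ∈ X, G.Adj s x := by
  by_contra hcon
  have hsub : reachSet G Z a ⊆ {b | b ∈ reachSet G Z a ∧ b ≠ s} := by
    refine reachSet_subset ⟨self_mem_reachSet, ?_⟩ ?_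
    · rintro rfl
      exact hcon ⟨v, hv, hva.symm⟩
    · rintro b ⟨hb, hbs⟩ c hc hbc
      refine ⟨reachSet_closed hb hbc hc, ?_⟩
      rintro rfl
      rcases hZ (reachSet_subset_self ha hb) with hbX | rfl | rfl
      · exact hcon ⟨b, hbX, hbc.symm⟩
      · exact hbs rfl
      · exact ht hb
  exact (hsub hs).2 rfl

/-- Of two distinct components attached to `X`, one contains neither `p` nor `q`. -/
theorem Reduced.component_avoids (h : Reduced G X I p q r L) {Z : Set V} {a b : V}
    (hZ : Z ⊆ X ∪ {p, q}) (ha : a ∈ Z) (hb : b ∈ Z) (hv : v ∈ X) (hva : G.Adj v a)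
    (hvb : G.Adj v b) (hab : b ∉ reachSet G Z a) :
    (p ∉ reachSet G Z a ∧ q ∉ reachSet G Z a) ∨ (p ∉ reachSet G Z b ∧ q ∉ reachSet G Z b) := by
  have hZ' : Z ⊆ X ∪ {q, p} := by rwa [Set.pair_comm]
  have hdis : ∀ c, c ∈ reachSet G Z a → c ∉ reachSet G Z b := fun c hca hcb =>
    hab (reachSet_trans hca (reachSet_symm hb hcb))
  by_contra hcon
  rw [not_or, not_and_or, not_and_or, not_not, not_not, not_not, not_not] at hcon
  obtain ⟨hca, hcb⟩ := hcon
  rcases hca with hpa | hqa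
  · rcases hcb with hpb | hqb
    · exact hdis _ hpa hpb
    · have hqa : q ∉ reachSet G Z a := fun hq => hdis _ hq hqb
      have hpb : p ∉ reachSet G Z b := hdis _ hpa
      exact hqa (reachSet_closed hpa (h.adj_pq
        (exists_adj_of_mem_reachSet hZ ha hv hva hpa hqa)
        (exists_adj_of_mem_reachSet hZ' hb hv hvb hqb hpb)) (reachSet_subset_self hb hqb))
  · rcases hcb with hpb | hqb
    · have hpa : p ∉ reachSet G Z a := fun hp => hdis _ hp hpb
      have hqb : q ∉ reachSet G Z b := hdis _ hqa
      exact hqb (reachSet_closed hpb (h.adj_pq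
        (exists_adj_of_mem_reachSet hZ hb hv hvb hpb hqb)
        (exists_adj_of_mem_reachSet hZ' ha hv hva hqa hpa)) (reachSet_subset_self ha hqa))
    · exact hdis _ hqa hqb

end Critical

section Ears

variable {V : Type*} {G : SimpleGraph V} {X I : Set V} {p q r v : V} {d : ℕ} {L : V → Finset ℕ}

/-- A vertex `w ∈ I` all of whose neighbours besides `r` are `v` and `y`, which together with `r`
form a triangle. -/
structure IsEar (G : SimpleGraph V) (X I : Set V) (q r v y w : V) : Prop where
  mem : w ∈ X
  mem_I : w ∈ I
  adj_r : G.Adj r w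
  adj_v : G.Adj v w
  adj_y : G.Adj w y
  y_mem : y ∈ X ∨ y = q
  r_adj_y : G.Adj r y
  v_adj_y : G.Adj v y
  eq_or_eq : ∀ x, (x ∈ X ∨ x = q) → G.Adj w x → x = v ∨ x = y

/-- The common neighbours of `r` and `v` other than the ears at `v`. -/
def commonNbrs (G : SimpleGraph V) (X I : Set V) (p q r v : V) : Set V :=
  {y | y ∈ X ∪ {p, q} ∧ G.Adj r y ∧ G.Adj v y ∧ ∀ z, ¬ IsEar G X I q r v z y}

theorem Reduced.ear_eq_or_eq (h : Reduced G X I p q r L) {y w : V} (hw : IsEar G X I q r v y w)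
    {x : V} (hx : x ∈ X ∪ {p, q}) (hwx : G.Adj w x) : x = v ∨ x = y := by
  rcases hx with hx | rfl | rfl
  · exact hw.eq_or_eq x (Or.inl hx) hwx
  · exact absurd hwx.symm (h.p_indep w hw.mem hw.mem_I)
  · exact hw.eq_or_eq x (Or.inr rfl) hwx

theorem Reduced.ear_base_mem (h : Reduced G X I p q r L) {y w : V}
    (hw : IsEar G X I q r v y w) : y ∈ commonNbrs G X I p q r v := by
  refine ⟨?_, hw.r_adj_y, hw.v_adj_y, ?_⟩
  · rcases hw.y_mem with hy | hy
    · exact Or.inl hy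
    · exact Or.inr (Or.inr hy)
  · exact fun z hz => h.indep w hw.mem hw.mem_I y hz.mem hz.mem_I hw.adj_y

theorem Reduced.mem_commonNbrs_of_eq (h : Reduced G X I p q r L) (hv : v ∈ X)
    (hrv : G.Adj r v) {s : V} (hs : s = p ∨ s = q) (hvs : G.Adj v s) :
    s ∈ commonNbrs G X I p q r v := by
  rcases hs with rfl | rfl
  · exact ⟨by simp, (h.adj_p_r hv hrv hv hvs.symm).symm, hvs, fun z hz => h.p_notMem hz.mem⟩
  · exact ⟨by simp, (h.adj_q_r hv hrv hv hvs.symm).symm, hvs, fun z hz => h.q_notMem hz.mem⟩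

theorem Reduced.not_three_ears (h : Reduced G X I p q r L) (hrv : G.Adj r v) {y w₁ w₂ w₃ : V}
    (hw₁ : IsEar G X I q r v y w₁) (hw₂ : IsEar G X I q r v y w₂)
    (hw₃ : IsEar G X I q r v y w₃) (h₁₂ : w₁ ≠ w₂) (h₁₃ : w₁ ≠ w₃) (h₂₃ : w₂ ≠ w₃) : False :=
  h.planar.not_three_three_of_connected (singleton_connected G w₃) hrv.ne hw₁.r_adj_y.ne
    hw₁.v_adj_y.ne h₁₂ (by simpa using h₁₃) (by simpa using h₂₃) (by simpa using hw₃.adj_r.ne)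
    (by simpa using hw₃.adj_v.ne) (by simpa using hw₃.adj_y.ne')
    hw₁.adj_r hw₁.adj_v hw₁.adj_y.symm hw₂.adj_r hw₂.adj_v hw₂.adj_y.symm
    ⟨w₃, rfl, hw₃.adj_r⟩ ⟨w₃, rfl, hw₃.adj_v⟩ ⟨w₃, rfl, hw₃.adj_y.symm⟩

theorem Reduced.not_two_ears [Finite V] (h : Reduced G X I p q r L)
    (ih : ColoringBelow I X.ncard) (hno : ¬ HasColoring G X q d L) (hv : v ∈ X)
    (hrv : G.Adj r v) {y y' w₁ w₂ : V} (hy' : y' ∈ commonNbrs G X I p q r v) (hyy' : y ≠ y')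
    (hw₁ : IsEar G X I q r v y w₁) (hw₂ : IsEar G X I q r v y w₂) (h₁₂ : w₁ ≠ w₂) : False := by
  have hrS := h.r_notMem_union hv hrv
  have hy := h.ear_base_mem hw₁
  obtain ⟨K, hK⟩ : ∃ K, K = reachSet G ((X ∪ {p, q}) \ {v, y}) y' := ⟨_, rfl⟩
  have hy'S : y' ∈ (X ∪ {p, q}) \ {v, y} := ⟨hy'.1, by simp [hy'.2.2.1.ne', hyy'.symm]⟩
  have hKS : K ⊆ (X ∪ {p, q}) \ {v, y} := hK ▸ reachSet_subset_self hy'S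
  have hvK : v ∉ K := fun hm => (hKS hm).2 (by simp)
  have hyK : y ∉ K := fun hm => (hKS hm).2 (by simp)
  have hy'K : y' ∈ K := hK ▸ self_mem_reachSet
  have hear : ∀ w, IsEar G X I q r v y w → w ∉ K := by
    intro w hw hwK
    have hsub : K ⊆ {s | s ∈ (X ∪ {p, q}) \ {v, y} ∧ s ≠ w} := by
      rw [hK]
      refine reachSet_subset ⟨hy'S, ?_⟩ ?_
      · rintro rfl
        exact hy'.2.2.2 y hw
      · rintro s ⟨hs, -⟩ t ht hst
        refine ⟨ht, ?_⟩
        rintro rfl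
        rcases h.ear_eq_or_eq hw hs.1 hst.symm with rfl | rfl
        · exact hs.2 (by simp)
        · exact hs.2 (by simp)
    exact (hsub hwK).2 rfl
  by_cases hadj : ∃ k ∈ K, G.Adj y k
  · exact h.planar.not_three_three_of_connected (hK ▸ reachSet_connected G _ y') hrv.ne
      hw₁.r_adj_y.ne hw₁.v_adj_y.ne h₁₂ (hear _ hw₁) (hear _ hw₂) (fun hm => hrS (hKS hm).1) hvK
      hyK hw₁.adj_r hw₁.adj_v hw₁.adj_y.symm hw₂.adj_r hw₂.adj_v hw₂.adj_y.symm
      ⟨y', hy'K, hy'.2.1⟩ ⟨y', hy'K, hy'.2.2.1⟩ hadj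
  · obtain ⟨Z, hZ⟩ : ∃ Z, Z = (X ∪ {p, q}) \ {v} := ⟨_, rfl⟩
    have hZS : Z ⊆ X ∪ {p, q} := hZ ▸ Set.sdiff_subset
    have hy'Z : y' ∈ Z := hZ ▸ ⟨hy'S.1, fun hm => hy'S.2 (Or.inl hm)⟩
    have hyZ : y ∈ Z := hZ ▸ ⟨hy.1, hy.2.2.1.ne'⟩
    have hsub : reachSet G Z y' ⊆ K := by
      refine reachSet_subset hy'K ?_
      intro s hs t ht hst
      have hty : t ≠ y := by
        rintro rfl
        exact hadj ⟨s, hs, hst.symm⟩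
      rw [hZ] at ht
      rw [hK] at hs ⊢
      refine reachSet_closed hs hst ⟨ht.1, ?_⟩
      rintro (rfl | rfl)
      · exact ht.2 rfl
      · exact hty rfl
    have hfin : ∀ a ∈ Z, p ∉ reachSet G Z a ∧ q ∉ reachSet G Z a → False := by
      rintro a ha ⟨hp, hq⟩
      have hsubZ := reachSet_subset_self (G := G) ha
      refine h.not_attached_single ih hno hv hrv (D := reachSet G Z a) ?_
        ⟨a, self_mem_reachSet⟩ ?_ ?_
      · intro b hb
        rcases hZS (hsubZ hb) with hbX | rfl | rfl
        · exact hbX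
        · exact absurd hb hp
        · exact absurd hb hq
      · intro hm
        have := hsubZ hm
        rw [hZ] at this
        exact this.2 rfl
      · intro s hs t ht hst
        by_cases htv : t = v
        · exact Or.inr htv
        · exact Or.inl (reachSet_closed hs hst (hZ ▸ ⟨ht, htv⟩))
    rcases h.component_avoids hZS hy'Z hyZ hv hy'.2.2.1 hy.2.2.1 (fun hm => hyK (hsub hm))
      with hc | hc
    · exact hfin y' hy'Z hc
    · exact hfin y hyZ hc

/-- The color `α` at `v` conflicts with the color `c` at `y`, directly or through an ear. -/
def Blocked (G : SimpleGraph V) (X I : Set V) (q r v y : V) (L : V → Finset ℕ) (c α : ℕ) : Prop :=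
  c = α ∨ ∃ w, IsEar G X I q r v y w ∧ L w ⊆ {α, c}

theorem Reduced.blocked_ne (h : Reduced G X I p q r L) (hv : v ∈ X) {y : V} {c α α' : ℕ}
    (hα : α ∈ L v) (hα' : α' ∈ L v) (hne : α ≠ α') (hb' : Blocked G X I q r v y L c α') :
    c ≠ α := by
  rintro rfl
  rcases hb' with hb' | ⟨w, hw, hwL⟩
  · exact hne hb'
  · have hsub : L w ⊆ L v ∩ L w := by
      intro x hx
      have hx' := hwL hx
      simp only [Finset.mem_insert, Finset.mem_singleton] at hx'
      rcases hx' with rfl | rfl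
      · exact Finset.mem_inter.2 ⟨hα', hx⟩
      · exact Finset.mem_inter.2 ⟨hα, hx⟩
    have h₁ := Finset.card_le_card hsub
    have h₂ := h.two_le w hw.mem
    have h₃ := h.sep v hv w hw.mem hw.adj_v
    omega

theorem Reduced.blocking_ears_ne (h : Reduced G X I p q r L) {y w w' : V} {c α α' : ℕ}
    (hne : α ≠ α') (hw : IsEar G X I q r v y w) (hwL : L w ⊆ {α, c}) (hw'L : L w' ⊆ {α', c}) :
    w ≠ w' := by
  rintro rfl
  have hsub : L w ⊆ {c} := by
    intro x hx
    have h₁ := hwL hx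
    have h₂ := hw'L hx
    simp only [Finset.mem_insert, Finset.mem_singleton] at h₁ h₂ ⊢
    rcases h₁ with rfl | h₁
    · rcases h₂ with h₂ | h₂
      · exact absurd h₂ hne
      · exact h₂
    · exact h₁
  have h₁ := Finset.card_le_card hsub
  have h₂ := h.two_le w hw.mem
  simp at h₁
  omega

theorem Reduced.exists_two_ears (h : Reduced G X I p q r L) (hv : v ∈ X) {y : V} {c α α' : ℕ}
    (hα : α ∈ L v) (hα' : α' ∈ L v) (hne : α ≠ α') (hb : Blocked G X I q r v y L c α)
    (hb' : Blocked G X I q r v y L c α') :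
    ∃ w w', IsEar G X I q r v y w ∧ IsEar G X I q r v y w' ∧ w ≠ w' := by
  obtain ⟨w, hw, hwL⟩ := hb.resolve_left (h.blocked_ne hv hα hα' hne hb')
  obtain ⟨w', hw', hwL'⟩ := hb'.resolve_left (h.blocked_ne hv hα' hα hne.symm hb)
  exact ⟨w, w', hw, hw', h.blocking_ears_ne hne hw hwL hwL'⟩

theorem Reduced.exists_unblocked [Finite V] (h : Reduced G X I p q r L)
    (ih : ColoringBelow I X.ncard) (hno : ¬ HasColoring G X q d L) (hv : v ∈ X) (hvI : v ∉ I)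
    (hrv : G.Adj r v) {a b : V} (hab : ∀ y ∈ commonNbrs G X I p q r v, y = a ∨ y = b)
    (ψ : V → ℕ) :
    ∃ α ∈ L v, ∀ y ∈ commonNbrs G X I p q r v, y ≠ p → ¬ Blocked G X I q r v y L (ψ y) α := by
  by_contra! hcon
  have htwo : ∀ y y' α α', y' ∈ commonNbrs G X I p q r v → y ≠ y' → α ∈ L v → α' ∈ L v → α ≠ α' →
      Blocked G X I q r v y L (ψ y) α → ¬ Blocked G X I q r v y L (ψ y) α' := by
    intro y y' α α' hy' hyy' hα hα' hne hb hb'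
    obtain ⟨w, w', hw, hw', hww'⟩ := h.exists_two_ears hv hα hα' hne hb hb'
    exact h.not_two_ears ih hno hv hrv hy' hyy' hw hw' hww'
  by_cases hvp : G.Adj v p
  · have hpW := h.mem_commonNbrs_of_eq hv hrv (Or.inl rfl) hvp
    obtain ⟨α₁, hα₁, α₂, hα₂, hne⟩ := Finset.one_lt_card.1 (h.two_le v hv)
    obtain ⟨y₁, hy₁, hy₁p, hb₁⟩ := hcon α₁ hα₁
    obtain ⟨y₂, hy₂, hy₂p, hb₂⟩ := hcon α₂ hα₂
    have heq : y₂ = y₁ := by grind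
    subst heq
    exact htwo _ p _ _ hpW hy₁p hα₁ hα₂ hne hb₁ hb₂
  · have h3 := h.three_le_of_not_p v hv hvI fun hp => hvp hp.symm
    obtain ⟨α₁, hα₁, α₂, hα₂, α₃, hα₃, h₁₂, h₁₃, h₂₃⟩ := Finset.two_lt_card.1 h3
    obtain ⟨y₁, hy₁, -, hb₁⟩ := hcon α₁ hα₁
    obtain ⟨y₂, hy₂, -, hb₂⟩ := hcon α₂ hα₂
    obtain ⟨y₃, hy₃, -, hb₃⟩ := hcon α₃ hα₃
    have hone : y₂ = y₁ ∧ y₃ = y₁ := by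
      by_contra hnot
      by_cases h' : y₂ = y₁
      · subst h'
        have hne : y₂ ≠ y₃ := fun he => hnot ⟨rfl, he.symm⟩
        exact htwo _ _ _ _ hy₃ hne hα₁ hα₂ h₁₂ hb₁ hb₂
      · by_cases h'' : y₃ = y₁
        · subst h''
          exact htwo _ _ _ _ hy₂ (fun he => h' he.symm) hα₁ hα₃ h₁₃ hb₁ hb₃
        · have heq : y₂ = y₃ := by grind
          subst heq
          exact htwo _ _ _ _ hy₁ h' hα₂ hα₃ h₂₃ hb₂ hb₃
    obtain ⟨rfl, rfl⟩ := hone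
    obtain ⟨w₁, hw₁, hL₁⟩ := hb₁.resolve_left (h.blocked_ne hv hα₁ hα₂ h₁₂ hb₂)
    obtain ⟨w₂, hw₂, hL₂⟩ := hb₂.resolve_left (h.blocked_ne hv hα₂ hα₁ h₁₂.symm hb₁)
    obtain ⟨w₃, hw₃, hL₃⟩ := hb₃.resolve_left (h.blocked_ne hv hα₃ hα₁ h₁₃.symm hb₁)
    exact h.not_three_ears hrv hw₁ hw₂ hw₃ (h.blocking_ears_ne h₁₂ hw₁ hL₁ hL₂)
      (h.blocking_ears_ne h₁₃ hw₁ hL₁ hL₃) (h.blocking_ears_ne h₂₃ hw₂ hL₂ hL₃)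

open Classical in
theorem Reduced.exists_three_common [Finite V] (h : Reduced G X I p q r L)
    (ih : ColoringBelow I X.ncard) (hno : ¬ HasColoring G X q d L) (hv : v ∈ X) (hvI : v ∉ I)
    (hrv : G.Adj r v) :
    ∃ x ∈ commonNbrs G X I p q r v, ∃ y ∈ commonNbrs G X I p q r v,
      ∃ z ∈ commonNbrs G X I p q r v, x ≠ y ∧ x ≠ z ∧ y ≠ z := by
  by_contra! hcon
  obtain ⟨a, b, hab⟩ : ∃ a b, ∀ y ∈ commonNbrs G X I p q r v, y = a ∨ y = b := by
    by_cases hex : ∃ a ∈ commonNbrs G X I p q r v, ∃ b ∈ commonNbrs G X I p q r v, a ≠ b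
    · obtain ⟨a, ha, b, hb, hab⟩ := hex
      refine ⟨a, b, fun y hy => ?_⟩
      by_contra! hy'
      exact hy'.2 (hcon a ha b hb y hy hab hy'.1.symm).symm
    · push Not at hex
      by_cases hne : ∃ a, a ∈ commonNbrs G X I p q r v
      · obtain ⟨a, ha⟩ := hne
        exact ⟨a, a, fun y hy => Or.inl (hex y hy a ha)⟩
      · exact ⟨v, v, fun y hy => absurd ⟨y, hy⟩ hne⟩
  refine hno (h.hasColoring_of_contract ih hv hrv {w | ∃ y, IsEar G X I q r v y w} ?_ ?_ ?_)
  · rintro ⟨y, hy⟩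
    exact hvI hy.mem_I
  · rintro w ⟨y, hw⟩ w' ⟨y', hw'⟩
    exact h.indep w hw.mem hw.mem_I w' hw'.mem hw'.mem_I
  intro φ
  obtain ⟨ψ, hψ⟩ : ∃ ψ : V → ℕ, ψ = fun y => if y = q then d else φ y := ⟨_, rfl⟩
  have hψX : ∀ y ∈ X, ψ y = φ y := by
    intro y hy
    have : y ≠ q := fun he => h.q_notMem (he ▸ hy)
    simp [hψ, this]
  have hψq : ψ q = d := by simp [hψ]
  obtain ⟨α, hα, hgood⟩ := h.exists_unblocked ih hno hv hvI hrv hab ψ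
  refine ⟨α, hα, ?_, ?_, ?_⟩
  · intro hqv
    have hqp : q ≠ p := by
      rintro rfl
      exact h.p_ne_q hv hqv rfl
    have hb := hgood q (h.mem_commonNbrs_of_eq hv hrv (Or.inr rfl) hqv.symm) hqp
    rw [hψq] at hb
    exact fun he => hb (Or.inl he.symm)
  · intro y hy hvy hry hyE
    have hyp : y ≠ p := fun he => h.p_notMem (he ▸ hy)
    have hb := hgood y ⟨Or.inl hy, hry, hvy, fun z hz => hyE ⟨z, hz⟩⟩ hyp
    rw [hψX y hy] at hb
    exact fun he => hb (Or.inl he)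
  · rintro w ⟨y, hw⟩
    have hyp : y ≠ p := by
      rintro rfl
      exact h.p_indep w hw.mem hw.mem_I hw.adj_y.symm
    have hb := hgood y (h.ear_base_mem hw) hyp
    have hnot : ¬ L w ⊆ {α, ψ y} := fun hs => hb (Or.inr ⟨w, hw, hs⟩)
    obtain ⟨β, hβ, hβ'⟩ := Finset.not_subset.1 hnot
    simp only [Finset.mem_insert, Finset.mem_singleton, not_or] at hβ'
    refine ⟨β, hβ, hβ'.1, ?_, ?_⟩
    · intro hqw
      rcases hw.eq_or_eq q (Or.inr rfl) hqw.symm with he | he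
      · exact absurd (he ▸ hv) h.q_notMem
      · rw [← hψq, he]
        exact hβ'.2
    · intro x hx hxv hwx
      rcases hw.eq_or_eq x (Or.inl hx) hwx with he | he
      · exact absurd he hxv
      · rw [← hψX x hx, he]
        exact hβ'.2

/-- Among the common neighbours of `r` and `v`, one separates two others. -/
theorem Reduced.exists_separated [Finite V] (h : Reduced G X I p q r L)
    (ih : ColoringBelow I X.ncard) (hno : ¬ HasColoring G X q d L) (hv : v ∈ X) (hvI : v ∉ I)
    (hrv : G.Adj r v) :
    ∃ y ∈ commonNbrs G X I p q r v, ∃ a ∈ commonNbrs G X I p q r v,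
      ∃ b ∈ commonNbrs G X I p q r v, a ≠ y ∧ b ≠ y ∧
        b ∉ reachSet G ((X ∪ {p, q}) \ {v, y}) a := by
  obtain ⟨x, hx, y, hy, z, hz, hxy, hxz, hyz⟩ := h.exists_three_common ih hno hv hvI hrv
  have hrS := h.r_notMem_union hv hrv
  have he : ∀ u, ((X ∪ {p, q}) \ {v}) \ {u} = (X ∪ {p, q}) \ {v, u} := by
    intro u
    rw [Set.sdiff_sdiff, Set.singleton_union]
  have := h.planar.exists_separator (Z := (X ∪ {p, q}) \ {v}) hrv (fun hm => hrS hm.1)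
    (fun hm => hm.2 rfl) hx.2.1 hy.2.1 hz.2.1 hx.2.2.1 hy.2.2.1 hz.2.2.1 hxy hxz hyz
  rw [he, he, he] at this
  rcases this with h' | h' | h'
  · exact ⟨x, hx, y, hy, z, hz, hxy.symm, hxz.symm, h'⟩
  · exact ⟨y, hy, z, hz, x, hx, hyz.symm, hxy, h'⟩
  · exact ⟨z, hz, x, hx, y, hy, hxz, hyz, h'⟩

end Ears

section Coloring

variable {V : Type*} {G : SimpleGraph V} {X I : Set V} {p q r v : V} {d : ℕ} {L : V → Finset ℕ}

theorem exists_third_of_not_isEar {y w : V}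
    (hw : w ∈ X) (hwI : w ∈ I) (hrw : G.Adj r w) (hvw : G.Adj v w) (hwy : G.Adj w y)
    (hy : y ∈ X ∨ y = q) (hry : G.Adj r y) (hvy : G.Adj v y)
    (hear : ¬ IsEar G X I q r v y w) :
    ∃ u, (u ∈ X ∨ u = q) ∧ G.Adj w u ∧ u ≠ v ∧ u ≠ y := by
  by_contra! hcon
  refine hear ⟨hw, hwI, hrw, hvw, hwy, hy, hry, hvy, fun x hx hwx => ?_⟩
  by_contra! hx'
  exact hx'.2 (hcon x hx hwx hx'.1)

/-- A part `D` of `X` attached only to `w ∈ I`, `v` and `y`, where `r, v, w, y` span a complete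
graph, is reducible. -/
theorem Reduced.not_attached_triangle [Finite V] (h : Reduced G X I p q r L)
    (ih : ColoringBelow I X.ncard) (hno : ¬ HasColoring G X q d L) (hv : v ∈ X)
    (hrv : G.Adj r v) {w y : V} (hw : w ∈ X) (hwI : w ∈ I) (hy : y ∈ X ∨ y = q)
    (hrw : G.Adj r w) (hvw : G.Adj v w) (hwy : G.Adj w y) (hry : G.Adj r y) (hvy : G.Adj v y)
    {D : Set V} (hDX : D ⊆ X) (hDc : (G.induce D).Connected) (hvD : v ∉ D) (hyD : y ∉ D)
    (hwD : w ∉ D) (hwadj : ∃ k ∈ D, G.Adj w k)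
    (hcl : ∀ s ∈ D, ∀ t ∈ X ∪ {p, q}, G.Adj s t → t ∈ D ∨ t = w ∨ t = v ∨ t = y) : False := by
  have hD : D.Nonempty := by
    obtain ⟨k, hk, -⟩ := hwadj
    exact ⟨k, hk⟩
  have hne : D ≠ X := fun he => hvD (he ▸ hv)
  have hyp : p ≠ y := by
    rintro rfl
    exact h.p_indep w hw hwI hwy.symm
  have hpD : ∀ u ∈ D, ¬ G.Adj p u := by
    intro u hu hpu
    rcases hcl u hu p (by simp) hpu.symm with h' | h' | h' | h'
    · exact h.p_notMem (hDX h')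
    · exact h.p_notMem (h' ▸ hw)
    · exact h.p_notMem (h' ▸ hv)
    · exact hyp h'
  have hqD : ∀ u ∈ D, G.Adj q u → q = y := by
    intro u hu hqu
    rcases hcl u hu q (by simp) hqu.symm with h' | h' | h' | h'
    · exact absurd (hDX h') h.q_notMem
    · exact absurd (h' ▸ hw) h.q_notMem
    · exact absurd (h' ▸ hv) h.q_notMem
    · exact h'
  have hcl' : ∀ u ∈ D, ∀ x ∈ X \ D, G.Adj u x → x = w ∨ x = v ∨ x = y := fun u hu x hx hux =>
    (hcl u hu x (Or.inl hx.1) hux).resolve_left hx.2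
  have hp' : w = p ∨ (∀ u ∈ D, ¬ G.Adj p u) ∧
      ((w ∉ X ∧ ∀ x, ¬ G.Adj w x) ∨ w ∈ X \ D ∧ w ∈ I) :=
    Or.inr ⟨hpD, Or.inr ⟨⟨hw, hwD⟩, hwI⟩⟩
  by_cases hr' : ∃ k ∈ D, G.Adj r k
  swap
  · push Not at hr'
    rcases hy with hyX | rfl
    · have hqD' : ∀ u ∈ D, ¬ G.Adj q u := fun u hu hqu => h.q_notMem (hqD u hu hqu ▸ hyX)
      refine hno (h.hasColoring_of_split ih hDX hD hne hp' (q' := v) (r' := y)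
        (Or.inr ⟨hqD', hv, hvD⟩) (Or.inr ⟨hr', hyX, hyD⟩) (fun _ _ => hvw.symm)
        (fun _ _ => hwy) (fun _ _ => hvy) ?_)
      exact hcl'
    · refine hno (h.hasColoring_of_split ih hDX hD hne hp' (q' := y) (r' := v)
        (Or.inl rfl) (Or.inr ⟨hr', hv, hvD⟩) (fun _ _ => hwy)
        (fun _ _ => hvw.symm) (fun _ _ => hvy.symm) ?_)
      intro u hu x hx hux
      have := hcl' u hu x hx hux
      tauto
  by_cases hv' : ∃ k ∈ D, G.Adj v k
  swap
  · have hq' : y = q ∨ (∀ u ∈ D, ¬ G.Adj q u) ∧ y ∈ X \ D := by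
      rcases hy with hyX | rfl
      · exact Or.inr ⟨fun u hu hqu => h.q_notMem (hqD u hu hqu ▸ hyX), hyX, hyD⟩
      · exact Or.inl rfl
    refine hno (h.hasColoring_of_split ih hDX hD hne hp' (q' := y) (r' := r)
      hq' (Or.inl rfl) (fun _ _ => hwy) (fun _ _ => hrw.symm) (fun _ _ => hry.symm) ?_)
    intro u hu x hx hux
    rcases hcl' u hu x hx hux with rfl | rfl | rfl
    · exact Or.inl rfl
    · exact absurd ⟨u, hu, hux.symm⟩ hv'
    · exact Or.inr (Or.inl rfl)
  by_cases hy' : ∃ k ∈ D, G.Adj y k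
  swap
  · have hqD' : ∀ u ∈ D, ¬ G.Adj q u := by
      intro u hu hqu
      exact hy' ⟨u, hu, hqD u hu hqu ▸ hqu⟩
    refine hno (h.hasColoring_of_split ih hDX hD hne hp' (q' := v) (r' := r)
      (Or.inr ⟨hqD', hv, hvD⟩) (Or.inl rfl) (fun _ _ => hvw.symm) (fun _ _ => hrw.symm)
      (fun _ _ => hrv.symm) ?_)
    intro u hu x hx hux
    rcases hcl' u hu x hx hux with rfl | rfl | rfl
    · exact Or.inl rfl
    · exact Or.inr (Or.inl rfl)
    · exact absurd ⟨u, hu, hux.symm⟩ hy'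
  have hset : ∀ {s t : V}, G.Adj s t → SetAdj G {s} {t} := fun h => ⟨_, rfl, _, rfl, h⟩
  have hset' : ∀ {s : V}, (∃ k ∈ D, G.Adj s k) → SetAdj G {s} D :=
    fun ⟨k, hk, hsk⟩ => ⟨_, rfl, k, hk, hsk⟩
  exact h.planar.not_five_of_connected (singleton_connected G y) (singleton_connected G w) hDc
    (by simpa using hwy.ne') (by simpa using hyD) (by simpa using hwD) hrv
    (by simpa using hry.ne) (by simpa using hrw.ne) (fun hm => h.r_notMem (hDX hm))
    (by simpa using hvy.ne) (by simpa using hvw.ne) hvD (hset hry) (hset hrw) (hset' hr')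
    (hset hvy) (hset hvw) (hset' hv') (hset hwy.symm) (hset' hy') (hset' hwadj)

theorem Reduced.not_separated [Finite V] (h : Reduced G X I p q r L)
    (ih : ColoringBelow I X.ncard) (hno : ¬ HasColoring G X q d L) (n : ℕ) {v y x : V}
    (hv : v ∈ X) (hvI : v ∉ I) (hrv : G.Adj r v) (hyS : y ∈ X ∪ {p, q}) (hry : G.Adj r y)
    (hvy : G.Adj v y) (hxW : x ∈ commonNbrs G X I p q r v) (hxy : x ≠ y)
    (hp : p ∉ reachSet G ((X ∪ {p, q}) \ {v, y}) x)
    (hq : q ∉ reachSet G ((X ∪ {p, q}) \ {v, y}) x)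
    (hn : (reachSet G ((X ∪ {p, q}) \ {v, y}) x).ncard = n) : False := by
  induction n using Nat.strong_induction_on generalizing v y x with
  | _ n IH =>
  obtain ⟨D, hD⟩ : ∃ D, D = reachSet G ((X ∪ {p, q}) \ {v, y}) x := ⟨_, rfl⟩
  rw [← hD] at hp hq hn
  have hxS : x ∈ (X ∪ {p, q}) \ {v, y} := ⟨hxW.1, by simp [hxW.2.2.1.ne', hxy]⟩
  have hDS : D ⊆ (X ∪ {p, q}) \ {v, y} := hD ▸ reachSet_subset_self hxS
  have hxD : x ∈ D := hD ▸ self_mem_reachSet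
  have hDX : D ⊆ X := by
    intro b hb
    rcases (hDS hb).1 with hbX | rfl | rfl
    · exact hbX
    · exact absurd hb hp
    · exact absurd hb hq
  have hvD : v ∉ D := fun hm => (hDS hm).2 (by simp)
  have hyD : y ∉ D := fun hm => (hDS hm).2 (by simp)
  have hcl : ∀ s ∈ D, ∀ t ∈ X ∪ {p, q}, G.Adj s t → t ∈ D ∨ t = v ∨ t = y := by
    intro s hs t ht hst
    by_contra! hcon
    rw [hD] at hs hcon
    exact hcon.1 (reachSet_closed hs hst ⟨ht, by simp [hcon.2.1, hcon.2.2]⟩)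
  obtain ⟨hyp, hyI⟩ := h.attachment ih hno hv hrv hDX ⟨x, hxD⟩ hvD hyD hry hvy hcl
  have hyXq : y ∈ X ∨ y = q := by
    rcases hyS with hy | hy | hy
    · exact Or.inl hy
    · exact absurd hy hyp
    · exact Or.inr hy
  by_cases hex : ∃ v' ∈ D, G.Adj r v' ∧ v' ∉ I
  · obtain ⟨v', hv'D, hrv', hv'I⟩ := hex
    have hv' := hDX hv'D
    obtain ⟨y', hy', a, ha, b, hb, hay, hby, hab⟩ := h.exists_separated ih hno hv' hv'I hrv'
    have hmem : ∀ c ∈ commonNbrs G X I p q r v', c ≠ y' → c ∈ (X ∪ {p, q}) \ {v', y'} :=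
      fun c hc hcy => ⟨hc.1, by simp [hc.2.2.1.ne', hcy]⟩
    have hfin : ∀ c ∈ commonNbrs G X I p q r v', c ≠ y' →
        v ∉ reachSet G ((X ∪ {p, q}) \ {v', y'}) c →
        y ∉ reachSet G ((X ∪ {p, q}) \ {v', y'}) c → False := by
      intro c hc hcy hvc hyc
      have hsub : reachSet G ((X ∪ {p, q}) \ {v', y'}) c ⊆
          D ∩ reachSet G ((X ∪ {p, q}) \ {v', y'}) c := by
        refine reachSet_subset ⟨?_, self_mem_reachSet⟩ ?_
        · rcases hcl v' hv'D c hc.1 hc.2.2.1 with h' | rfl | rfl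
          · exact h'
          · exact absurd self_mem_reachSet hvc
          · exact absurd self_mem_reachSet hyc
        · rintro s ⟨hsD, hs⟩ t ht hst
          have htc := reachSet_closed hs hst ht
          refine ⟨?_, htc⟩
          rcases hcl s hsD t ht.1 hst with h' | rfl | rfl
          · exact h'
          · exact absurd htc hvc
          · exact absurd htc hyc
      have hv'c : v' ∉ reachSet G ((X ∪ {p, q}) \ {v', y'}) c := fun hm =>
        (reachSet_subset_self (hmem c hc hcy) hm).2 (by simp)
      refine IH _ ?_ hv' hv'I hrv' hy'.1 hy'.2.1 hy'.2.2.1 hc hcy (fun hm => hp (hsub hm).1)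
        (fun hm => hq (hsub hm).1) rfl
      rw [← hn]
      exact Set.ncard_lt_ncard ⟨fun t ht => (hsub ht).1, fun hs => hv'c (hs hv'D)⟩
    have haS := hmem a ha hay
    have hbS := hmem b hb hby
    have hdis : ∀ c, c ∈ reachSet G ((X ∪ {p, q}) \ {v', y'}) a →
        c ∉ reachSet G ((X ∪ {p, q}) \ {v', y'}) b := fun c hca hcb =>
      hab (reachSet_trans hca (reachSet_symm hbS hcb))
    by_cases hva : v ∈ reachSet G ((X ∪ {p, q}) \ {v', y'}) a
    · refine hfin b hb hby (hdis v hva) fun hyb => ?_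
      exact hdis y (reachSet_closed hva hvy (reachSet_subset_self hbS hyb)) hyb
    by_cases hya : y ∈ reachSet G ((X ∪ {p, q}) \ {v', y'}) a
    · refine hfin b hb hby (fun hvb => ?_) (hdis y hya)
      exact hdis y hya (reachSet_closed hvb hvy (reachSet_subset_self haS hya))
    · exact hfin a ha hay hva hya
  · push Not at hex
    have hxX := hDX hxD
    have hxI : x ∈ I := hex x hxD hxW.2.1
    obtain ⟨y₁, y₂, hne, ⟨hy₁, hxy₁, hry₁⟩, hy₂, hxy₂, hry₂⟩ :=
      h.exists_two_common ih hno hxX hxW.2.1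
    have hvy' : ∀ t, (t ∈ X ∨ t = q) → G.Adj x t → G.Adj r t → t = v ∨ t = y := by
      intro t ht hxt hrt
      have htS : t ∈ X ∪ {p, q} := by
        rcases ht with ht | ht
        · exact Or.inl ht
        · exact Or.inr (Or.inr ht)
      rcases hcl x hxD t htS hxt with htD | h'
      · exact absurd hxt (h.indep x hxX hxI t (hDX htD) (hex t htD hrt))
      · exact h'
    have hxadjy : G.Adj x y := by
      rcases hvy' y₁ hy₁ hxy₁ hry₁ with h₁ | h₁
      · rcases hvy' y₂ hy₂ hxy₂ hry₂ with h₂ | h₂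
        · exact absurd (h₁.trans h₂.symm) hne
        · exact h₂ ▸ hxy₂
      · exact h₁ ▸ hxy₁
    obtain ⟨u, hu, hxu, huv, huy⟩ := exists_third_of_not_isEar hxX hxI hxW.2.1 hxW.2.2.1 hxadjy hyXq
      hry hvy (hxW.2.2.2 y)
    have huS : u ∈ X ∪ {p, q} := by
      rcases hu with hu | hu
      · exact Or.inl hu
      · exact Or.inr (Or.inr hu)
    have huD : u ∈ D := by
      rcases hcl x hxD u huS hxu with h' | h' | h'
      · exact h'
      · exact absurd h' huv
      · exact absurd h' huy
    have hu' : u ∈ D \ {x} := ⟨huD, hxu.ne'⟩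
    have hsub := reachSet_subset_self (G := G) hu'
    refine h.not_attached_triangle ih hno hv hrv hxX hxI hyXq hxW.2.1 hxW.2.2.1 hxadjy hry hvy
      (D := reachSet G (D \ {x}) u) (fun t ht => hDX (hsub ht).1) (reachSet_connected G _ u)
      (fun hm => hvD (hsub hm).1) (fun hm => hyD (hsub hm).1) (fun hm => (hsub hm).2 rfl)
      ⟨u, self_mem_reachSet, hxu⟩ ?_
    intro s hs t ht hst
    by_cases htx : t = x
    · exact Or.inr (Or.inl htx)
    rcases hcl s (hsub hs).1 t ht hst with h' | h'
    · exact Or.inl (reachSet_closed hs hst ⟨h', htx⟩)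
    · exact Or.inr (Or.inr h')

theorem Reduced.hasColoring_of_active [Finite V] (h : Reduced G X I p q r L)
    (ih : ColoringBelow I X.ncard) (hact : ∃ x ∈ X, G.Adj r x) (d : ℕ) :
    HasColoring G X q d L := by
  by_contra hno
  obtain ⟨v, hv, hrv, hvI⟩ : ∃ v ∈ X, G.Adj r v ∧ v ∉ I := by
    by_contra! hcon
    obtain ⟨x, hx, hrx⟩ := hact
    obtain ⟨y₁, y₂, hne, ⟨hy₁, hxy₁, hry₁⟩, hy₂, hxy₂, hry₂⟩ :=
      h.exists_two_common ih hno hx hrx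
    have hq : ∀ y, (y ∈ X ∨ y = q) → G.Adj x y → G.Adj r y → y = q := by
      rintro y (hy | hy) hxy hry
      · exact absurd hxy (h.indep x hx (hcon x hx hrx) y hy (hcon y hy hry))
      · exact hy
    exact hne ((hq y₁ hy₁ hxy₁ hry₁).trans (hq y₂ hy₂ hxy₂ hry₂).symm)
  obtain ⟨y, hy, a, ha, b, hb, hay, hby, hab⟩ := h.exists_separated ih hno hv hvI hrv
  have hmem : ∀ c ∈ commonNbrs G X I p q r v, c ≠ y → c ∈ (X ∪ {p, q}) \ {v, y} :=
    fun c hc hcy => ⟨hc.1, by simp [hc.2.2.1.ne', hcy]⟩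
  rcases h.component_avoids Set.sdiff_subset (hmem a ha hay) (hmem b hb hby) hv ha.2.2.1
    hb.2.2.1 hab with hc | hc
  · exact h.not_separated ih hno _ hv hvI hrv hy.1 hy.2.1 hy.2.2.1 ha hay hc.1 hc.2 rfl
  · exact h.not_separated ih hno _ hv hvI hrv hy.1 hy.2.1 hy.2.2.1 hb hby hc.1 hc.2 rfl

end Coloring

section Main

variable {V : Type*}

open Classical in
theorem coloringBelow [Finite V] (I : Set V) (n : ℕ) : ColoringBelow I n := by
  induction n with
  | zero => exact fun _ _ _ _ _ _ _ hn => absurd hn (Nat.not_lt_zero _)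
  | succ n IH =>
  have active : ∀ (G : SimpleGraph V) (X : Set V) (p q r : V) (d : ℕ) (L : V → Finset ℕ),
      X.ncard < n + 1 → Reduced G X I p q r L → (∃ x ∈ X, G.Adj r x) → HasColoring G X q d L :=
    fun G X p q r d L hn h hact => h.hasColoring_of_active
      (fun G' X' p' q' r' d' L' hn' => IH G' X' p' q' r' d' L' (by omega)) hact d
  intro G X p q r d L hn h
  obtain ⟨o, ho, hiso⟩ := h.isolated
  by_cases hr : ∃ x ∈ X, G.Adj r x
  · exact active G X p q r d L hn h hr
  push Not at hr
  have hno : ∀ {P : Prop}, (∃ x ∈ X, G.Adj o x) → P := fun ⟨x, _, hx⟩ => absurd hx (hiso x)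
  by_cases hq : ∃ x ∈ X, G.Adj q x
  · have hsub : ∀ u, (if G.Adj q u then (L u).erase d else L u) ⊆ L u := by
      intro u
      split_ifs
      · exact Finset.erase_subset _ _
      · exact Finset.Subset.refl _
    have hcard : ∀ u, (L u).card ≤ ((L u).erase d).card + 1 := fun u => by
      have := Finset.pred_card_le_card_erase (s := L u) (a := d)
      omega
    have hred : Reduced G X I p o q (fun u => if G.Adj q u then (L u).erase d else L u) := by
      refine ⟨h.planar, h.p_notMem, ho, h.q_notMem, fun _ => hno, h.adj_pq, hno, h.indep,
        h.p_indep, ?_, ?_, ?_, ?_, ?_, ?_, h.isolated⟩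
      · exact fun u hu v hv huv => le_trans (Finset.card_le_card
          (Finset.inter_subset_inter (hsub u) (hsub v))) (h.sep u hu v hv huv)
      · intro u hu
        have hc := hcard u
        have h3 : 3 ≤ (L u).card := by
          by_cases huI : u ∈ I
          · exact h.three_le_of_mem u hu huI (hr u hu)
          · exact h.three_le_of_not_r u hu huI (hr u hu)
        split_ifs <;> omega
      · intro u hu huI hqu
        simpa only [hqu, if_false] using h.three_le_of_mem u hu huI (hr u hu)
      · intro u hu huI hpu
        have hc := hcard u
        have h4 := h.four_le u hu huI hpu (hr u hu)
        split_ifs <;> omega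
      · intro u hu huI hqu
        simpa only [hqu, if_false] using h.three_le_of_not_r u hu huI (hr u hu)
      · intro u hu huI hpu hqu
        simpa only [hqu, if_false] using h.four_le u hu huI hpu (hr u hu)
    obtain ⟨φ, hφ⟩ := active G X p o q d _ hn hred hq
    refine ⟨φ, fun u hu => ?_⟩
    obtain ⟨h₁, -, h₂⟩ := hφ u hu
    refine ⟨hsub u h₁, ?_, h₂⟩
    intro hqu
    simp only [hqu, if_true, Finset.mem_erase] at h₁
    exact h₁.1
  push Not at hq
  by_cases hp : ∃ x ∈ X, G.Adj p x
  · have hred : Reduced G X I o o p L :=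
      ⟨h.planar, ho, ho, h.p_notMem, hno, hno, hno, h.indep, fun u _ _ => hiso u, h.sep, h.two_le,
        fun u hu huI _ => h.three_le_of_mem u hu huI (hr u hu),
        fun u hu huI _ => h.three_le_of_not_r u hu huI (hr u hu),
        fun u hu huI _ => h.three_le_of_not_r u hu huI (hr u hu),
        fun u hu huI _ hpu => h.four_le u hu huI hpu (hr u hu), h.isolated⟩
    obtain ⟨φ, hφ⟩ := active G X o o p d L hn hred hp
    refine ⟨φ, fun u hu => ?_⟩
    obtain ⟨h₁, -, h₂⟩ := hφ u hu
    exact ⟨h₁, fun hqu => absurd hqu (hq u hu), h₂⟩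
  push Not at hp
  by_cases hX : X.Nonempty
  swap
  · exact ⟨fun _ => 0, fun u hu => absurd ⟨u, hu⟩ hX⟩
  obtain ⟨x, hx⟩ := hX
  obtain ⟨c, hc⟩ := Finset.card_pos.1 (lt_of_lt_of_le Nat.zero_lt_two (h.two_le x hx))
  have hno' : ∀ {P : Prop}, (∃ u ∈ X \ {x}, G.Adj o u) → P :=
    fun ⟨u, _, hu⟩ => absurd hu (hiso u)
  have hred : Reduced G (X \ {x}) I o x o L :=
    ⟨h.planar, fun hm => ho hm.1, fun hm => hm.2 rfl, fun hm => ho hm.1, hno', hno',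
      fun _ => hno', (h.mono Set.sdiff_subset).indep, fun u _ _ => hiso u,
      (h.mono Set.sdiff_subset).sep, (h.mono Set.sdiff_subset).two_le,
      fun u hu huI _ => h.three_le_of_mem u hu.1 huI (hr u hu.1),
      fun u hu huI _ => h.three_le_of_not_r u hu.1 huI (hr u hu.1),
      fun u hu huI _ => h.three_le_of_not_r u hu.1 huI (hr u hu.1),
      fun u hu huI _ _ => h.four_le u hu.1 huI (hp u hu.1) (hr u hu.1),
      (h.mono Set.sdiff_subset).isolated⟩
  have hlt : (X \ {x}).ncard < X.ncard :=
    Set.ncard_lt_ncard ⟨Set.sdiff_subset, fun hs => (hs hx).2 rfl⟩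
  obtain ⟨φ, hφ⟩ := IH G (X \ {x}) o x o c L (by omega) hred
  refine ⟨Function.update φ x c, fun u hu => ?_⟩
  by_cases hux : u = x
  · subst hux
    rw [Function.update_self]
    refine ⟨hc, fun hqu => absurd hqu (hq u hu), ?_⟩
    intro v hv huv
    rw [Function.update_of_ne huv.ne']
    exact ((hφ v ⟨hv, huv.ne'⟩).2.1 huv).symm
  · obtain ⟨h₁, h₂, h₃⟩ := hφ u ⟨hu, hux⟩
    rw [Function.update_of_ne hux]
    refine ⟨h₁, fun hqu => absurd hqu (hq u hu), ?_⟩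
    intro v hv huv
    by_cases hvx : v = x
    · subst hvx
      rw [Function.update_self]
      exact h₂ huv.symm
    · rw [Function.update_of_ne hvx]
      exact h₃ v ⟨hv, hvx⟩ huv

theorem IsPlanar.map_some {G : SimpleGraph V} (hG : IsPlanar G) :
    IsPlanar (G.map Function.Embedding.some) := by
  refine isPlanar_of_model hG (fun o => {x | some x = o}) ?_ ?_ ?_
  · intro a b hab
    rw [Set.disjoint_left]
    exact fun x hx hx' => hab (hx.symm.trans hx')
  · intro a b hab
    obtain ⟨u, v, -, rfl, -⟩ := (SimpleGraph.map_adj _ _ _ _).1 hab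
    have : {x | some x = Function.Embedding.some u} = {u} := by
      ext x
      simp
    rw [this]
    exact singleton_connected G u
  · intro a b hab
    obtain ⟨u, v, huv, rfl, rfl⟩ := (SimpleGraph.map_adj _ _ _ _).1 hab
    exact ⟨u, rfl, v, rfl, huv⟩

end Main

theorem stmt_7 {V : Type*} [Fintype V] (G : SimpleGraph V) (hG : IsPlanar G)
    (I : Set V) (hI : ∀ u ∈ I, ∀ v ∈ I, ¬ G.Adj u v)
    (L : V → Finset ℕ)
    (hsep : ∀ u v, G.Adj u v → (L u ∩ L v).card ≤ 1)
    (hI3 : ∀ v ∈ I, 3 ≤ (L v).card)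
    (h4 : ∀ v, v ∉ I → 4 ≤ (L v).card) :
    ∃ φ, ProperListColoring G L φ := by
  have hadj : ∀ u v, (G.map Function.Embedding.some).Adj (some u) (some v) ↔ G.Adj u v :=
    fun u v => SimpleGraph.map_adj_apply
  have hiso : ∀ x, ¬ (G.map Function.Embedding.some).Adj none x := by
    intro x hx
    obtain ⟨u, v, -, hu, -⟩ := (SimpleGraph.map_adj _ _ _ _).1 hx
    exact Option.some_ne_none u hu
  have hI' : ∀ u, some u ∈ some '' I ↔ u ∈ I := fun u => by simp
  have h3 : ∀ v, 3 ≤ (L v).card := fun v => by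
    by_cases hv : v ∈ I
    · exact hI3 v hv
    · exact le_trans (by norm_num) (h4 v hv)
  have hnone : (none : Option V) ∉ Set.range some := by simp
  have hno : ∀ {P : Prop},
      (∃ x ∈ Set.range some, (G.map Function.Embedding.some).Adj none x) → P :=
    fun ⟨x, _, hx⟩ => absurd hx (hiso x)
  have hred : Reduced (G.map Function.Embedding.some) (Set.range some) (some '' I) none none none
      (fun o => o.elim ∅ L) := by
    refine ⟨hG.map_some, hnone, hnone, hnone, hno, hno, hno, ?_, fun u _ _ => hiso u, ?_, ?_, ?_,
      ?_, ?_, ?_, none, hnone, hiso⟩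
    · rintro _ ⟨u, rfl⟩ hu _ ⟨v, rfl⟩ hv
      rw [hadj]
      exact hI u ((hI' u).1 hu) v ((hI' v).1 hv)
    · rintro _ ⟨u, rfl⟩ _ ⟨v, rfl⟩ huv
      exact hsep u v ((hadj u v).1 huv)
    · rintro _ ⟨u, rfl⟩
      exact le_trans (by norm_num) (h3 u)
    · rintro _ ⟨u, rfl⟩ - -
      exact h3 u
    · rintro _ ⟨u, rfl⟩ - -
      exact h3 u
    · rintro _ ⟨u, rfl⟩ - -
      exact h3 u
    · rintro _ ⟨u, rfl⟩ hu - -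
      exact h4 u fun h => hu ((hI' u).2 h)
  obtain ⟨φ, hφ⟩ := coloringBelow (some '' I) _ _ _ _ _ _ 0 _ (Nat.lt_succ_self _) hred
  refine ⟨fun v => φ (some v), fun v => (hφ (some v) ⟨v, rfl⟩).1, fun u v huv => ?_⟩
  exact (hφ (some u) ⟨u, rfl⟩).2.2 (some v) ⟨v, rfl⟩ ((hadj u v).2 huv)
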